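/- arXiv:1512.07955 — 4 statements merged into one kernel-verified Lean document; each statement's English description precedes it below -/
import Mathlib

section
/- Let β, q ∈ ℂ with β ≠ 0, let M ≥ N ≥ 1, and let u₁,…,u_N be nonzero complex numbers such that u_j + qβu_j⁻¹ ≠ 0, −β⁻¹u_j − u_j⁻¹ ≠ 0 for all j, and u_j² ≠ u_k², q u_j² ≠ u_k² for all j ≠ k. Then for any 1 ≤ x₁ < ⋯ < x_N ≤ M, the wavefunction of the model built from L(u) satisfies ⟨x₁⋯x_N|ψ({u}_N)⟩ = ∏_{j=1}^N [(1−q)(u_j+qβu_j⁻¹)^M / (−β⁻¹u_j−u_j⁻¹)] · ∏_{1≤j<k≤N} (q−u_j⁻²u_k²)/(1−u_j⁻²u_k²) · Σ_{σ∈S_N} ∏_{1≤j<k≤N, σ(j)>σ(k)} (1−q u_{σ(j)}² u_{σ(k)}⁻²)/(q−u_{σ(j)}² u_{σ(k)}⁻²) · ∏_{j=1}^N ((−β⁻¹u_{σ(j)}−u_{σ(j)}⁻¹)/(u_{σ(j)}+qβu_{σ(j)}⁻¹))^{x_j}. -/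
noncomputable section

/-- The pair `(a,b)` of qubit indices as an index in `Fin 4` (basis order `|00⟩,|01⟩,|10⟩,|11⟩`). -/
def pidx (p : Fin 2 × Fin 2) : Fin 4 :=
  ⟨2 * p.1.val + p.2.val, by have := p.1.isLt; have := p.2.isLt; omega⟩

/-- Reindex a `4 × 4` matrix as a matrix on `ℂ² ⊗ ℂ²` (auxiliary factor first). -/
def toPair (A : Matrix (Fin 4) (Fin 4) ℂ) : Matrix (Fin 2 × Fin 2) (Fin 2 × Fin 2) ℂ :=
  Matrix.of fun p q => A (pidx p) (pidx q)

/-- `L_{aj}`: a (possibly site-dependent) two-site operator acting on the auxiliary space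
and the `j`-th site of the quantum space `V^{⊗M}`, identity elsewhere. -/
def siteOp (M : ℕ) (Lm : Fin M → Matrix (Fin 2 × Fin 2) (Fin 2 × Fin 2) ℂ) (j : Fin M) :
    Matrix (Fin 2 × (Fin M → Fin 2)) (Fin 2 × (Fin M → Fin 2)) ℂ :=
  Matrix.of fun s t =>
    Lm j (s.1, s.2 j) (t.1, t.2 j) * (if ∀ i, i ≠ j → s.2 i = t.2 i then 1 else 0)

/-- The monodromy matrix `T_a = L_{aM} ⋯ L_{a1}`. -/
def monodromy (M : ℕ) (Lm : Fin M → Matrix (Fin 2 × Fin 2) (Fin 2 × Fin 2) ℂ) :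
    Matrix (Fin 2 × (Fin M → Fin 2)) (Fin 2 × (Fin M → Fin 2)) ℂ :=
  ((List.ofFn fun j : Fin M => siteOp M Lm j).reverse).prod

/-- The operator `B` on `V^{⊗M}`: the upper-right block `⟨0|_a T_a |1⟩_a` of the monodromy. -/
def Bop (M : ℕ) (Lm : Fin M → Matrix (Fin 2 × Fin 2) (Fin 2 × Fin 2) ℂ) :
    Matrix (Fin M → Fin 2) (Fin M → Fin 2) ℂ :=
  Matrix.of fun s t => monodromy M Lm (0, s) (1, t)

/-- The configuration of `V^{⊗M}` with particles (`|1⟩`) at the positions `x` and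
`|0⟩` elsewhere. -/
def conf {M N : ℕ} (x : Fin N → Fin M) : Fin M → Fin 2 :=
  fun i => if ∃ j, x j = i then 1 else 0

/-- The `β`-deformed XXZ-type L-operator. -/
def LXXZb (q β u : ℂ) : Matrix (Fin 2 × Fin 2) (Fin 2 × Fin 2) ℂ :=
  toPair !![u + q * β * u⁻¹, 0, 0, 0;
            0, q * (u + β * u⁻¹), 1 - q, 0;
            0, 1 - q, -β⁻¹ * u - u⁻¹, 0;
            0, 0, 0, -β⁻¹ * u - q * u⁻¹]

section BetheVector

open Finset

/-- The weight of `|0⟩_a |0⟩ → |0⟩_a |0⟩` in `LXXZb`. -/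
def wtA (q β u : ℂ) : ℂ := u + q * β * u⁻¹

/-- The weight of `|0⟩_a |1⟩ → |0⟩_a |1⟩` in `LXXZb`. -/
def wtB (q β u : ℂ) : ℂ := q * (u + β * u⁻¹)

/-- The weight of `|1⟩_a |0⟩ → |1⟩_a |0⟩` in `LXXZb`. -/
def wtD (β u : ℂ) : ℂ := -β⁻¹ * u - u⁻¹

/-- The weight of `|1⟩_a |1⟩ → |1⟩_a |1⟩` in `LXXZb`. -/
def wtE (q β u : ℂ) : ℂ := -β⁻¹ * u - q * u⁻¹

/-- The diagonal exchange factor of the Bethe ansatz. -/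
def exchF (q u v : ℂ) : ℂ := (q * u ^ 2 - v ^ 2) / (u ^ 2 - v ^ 2)

/-- The off-diagonal exchange factor of the Bethe ansatz. -/
def exchG (q v u : ℂ) : ℂ := (1 - q) * u * v / (u ^ 2 - v ^ 2)

section WeightIdentities

variable {q β u v w : ℂ}

lemma wtB_add_wtA_mul_exchG (hu : u ≠ 0) (hv : v ≠ 0) (h : u ^ 2 ≠ v ^ 2) :
    wtB q β v + wtA q β u * exchG q v u = wtA q β v * exchF q v u := by
  have h1 : u ^ 2 - v ^ 2 ≠ 0 := sub_ne_zero.2 h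
  unfold wtA wtB exchG exchF
  rw [← neg_sub (u ^ 2) (v ^ 2)]
  field_simp
  ring

lemma sq_add_wtD_mul_wtA_mul_exchG (hβ : β ≠ 0) (hu : u ≠ 0) (hv : v ≠ 0) (h : u ^ 2 ≠ v ^ 2) :
    (1 - q) * (1 - q) + wtD β v * (wtA q β u * exchG q v u)
      = wtD β u * (wtA q β v * exchG q v u) := by
  have h1 : u ^ 2 - v ^ 2 ≠ 0 := sub_ne_zero.2 h
  unfold wtA wtD exchG
  field_simp
  ring

lemma wtE_eq (hβ : β ≠ 0) (hu : u ≠ 0) (hv : v ≠ 0) (h : u ^ 2 ≠ v ^ 2) :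
    wtE q β v = wtD β v * exchF q u v + wtD β u * exchG q v u := by
  have h1 : u ^ 2 - v ^ 2 ≠ 0 := sub_ne_zero.2 h
  unfold wtE wtD exchG exchF
  field_simp
  ring

lemma wtE_mul_exchange (hβ : β ≠ 0) (hu : u ≠ 0) (hv : v ≠ 0) (hw : w ≠ 0)
    (huv : u ^ 2 ≠ v ^ 2) (hwv : w ^ 2 ≠ v ^ 2) (huw : u ^ 2 ≠ w ^ 2) :
    wtE q β v * (wtA q β u * exchF q u w * exchG q v u + wtA q β w * exchF q w u * exchG q v w)
      = wtA q β v * (wtD β u * exchG q v u * exchF q w u * exchF q v w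
          + wtD β w * exchG q v w * exchF q u w * exchF q v u) := by
  have h1 : u ^ 2 - v ^ 2 ≠ 0 := sub_ne_zero.2 huv
  have h2 : w ^ 2 - v ^ 2 ≠ 0 := sub_ne_zero.2 hwv
  have h3 : u ^ 2 - w ^ 2 ≠ 0 := sub_ne_zero.2 huw
  unfold wtA wtD wtE exchG exchF
  rw [← neg_sub (u ^ 2) (w ^ 2), ← neg_sub (u ^ 2) (v ^ 2), ← neg_sub (w ^ 2) (v ^ 2)]
  field_simp
  ring

end WeightIdentities

section Monodromy

lemma sum_snoc {M : ℕ} (F : (Fin (M + 1) → Fin 2) → ℂ) :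
    ∑ t, F t = ∑ b : Fin 2, ∑ t : Fin M → Fin 2, F (Fin.snoc t b) := by
  rw [← (Fin.snocEquiv (fun _ : Fin (M + 1) => Fin 2)).sum_comp, Fintype.sum_prod_type]
  rfl

lemma siteOp_castSucc {M : ℕ} (L : Matrix (Fin 2 × Fin 2) (Fin 2 × Fin 2) ℂ) (j : Fin M)
    (i k : Fin 2) (s t : Fin (M + 1) → Fin 2) :
    siteOp (M + 1) (fun _ => L) j.castSucc (i, s) (k, t)
      = siteOp M (fun _ => L) j (i, Fin.init s) (k, Fin.init t)
        * if s (Fin.last M) = t (Fin.last M) then 1 else 0 := by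
  have key : (∀ i, i ≠ j.castSucc → s i = t i) ↔
      (∀ i, i ≠ j → Fin.init s i = Fin.init t i) ∧ s (Fin.last M) = t (Fin.last M) := by
    rw [Fin.forall_fin_succ']
    simp [Fin.init, (Fin.castSucc_ne_last j).symm]
  simp only [siteOp, Matrix.of_apply, key, ite_and, mul_assoc]
  congr 1
  split_ifs <;> simp

lemma siteOp_last {M : ℕ} (L : Matrix (Fin 2 × Fin 2) (Fin 2 × Fin 2) ℂ)
    (i k : Fin 2) (s t : Fin (M + 1) → Fin 2) :
    siteOp (M + 1) (fun _ => L) (Fin.last M) (i, s) (k, t)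
      = L (i, s (Fin.last M)) (k, t (Fin.last M))
        * if Fin.init s = Fin.init t then 1 else 0 := by
  have key : (∀ i, i ≠ Fin.last M → s i = t i) ↔ Fin.init s = Fin.init t := by
    rw [Fin.forall_fin_succ', funext_iff]
    simp [Fin.init, Fin.castSucc_ne_last]
  simp only [siteOp, Matrix.of_apply, key]

lemma prod_siteOp_castSucc {M : ℕ} (L : Matrix (Fin 2 × Fin 2) (Fin 2 × Fin 2) ℂ)
    (l : List (Fin M)) (i k : Fin 2) (s t : Fin (M + 1) → Fin 2) :
    (l.map fun j => siteOp (M + 1) (fun _ => L) j.castSucc).prod (i, s) (k, t)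
      = (l.map fun j => siteOp M (fun _ => L) j).prod (i, Fin.init s) (k, Fin.init t)
        * if s (Fin.last M) = t (Fin.last M) then 1 else 0 := by
  induction l generalizing i s with
  | nil =>
    have key : s = t ↔ Fin.init s = Fin.init t ∧ s (Fin.last M) = t (Fin.last M) := by
      rw [funext_iff, Fin.forall_fin_succ', funext_iff]
      rfl
    simp only [List.map_nil, List.prod_nil, Matrix.one_apply, Prod.mk.injEq, key]
    split_ifs <;> simp_all
  | cons j l ih =>
    simp only [List.map_cons, List.prod_cons, Matrix.mul_apply, Fintype.sum_prod_type, ih,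
      siteOp_castSucc, sum_snoc, Fin.init_snoc, Fin.snoc_last, Finset.sum_mul]
    refine Finset.sum_congr rfl fun a _ => ?_
    rw [Finset.sum_comm]
    refine Finset.sum_congr rfl fun r _ => ?_
    rw [Finset.sum_eq_single (s (Fin.last M))]
    · simp
    · intro b _ hb
      simp [hb.symm]
    · simp

lemma monodromy_zero (Lm : Fin 0 → Matrix (Fin 2 × Fin 2) (Fin 2 × Fin 2) ℂ) :
    monodromy 0 Lm = 1 := by
  simp [monodromy]

lemma monodromy_succ {M : ℕ} (L : Matrix (Fin 2 × Fin 2) (Fin 2 × Fin 2) ℂ)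
    (i k : Fin 2) (s t : Fin (M + 1) → Fin 2) :
    monodromy (M + 1) (fun _ => L) (i, s) (k, t)
      = ∑ a, L (i, s (Fin.last M)) (a, t (Fin.last M))
          * monodromy M (fun _ => L) (a, Fin.init s) (k, Fin.init t) := by
  have hprod : monodromy (M + 1) (fun _ => L) = siteOp (M + 1) (fun _ => L) (Fin.last M)
      * ((List.finRange M).reverse.map fun j => siteOp (M + 1) (fun _ => L) j.castSucc).prod := by
    rw [monodromy, List.ofFn_succ']
    simp [List.concat_eq_append, List.ofFn_eq_map]
  have hM : monodromy M (fun _ => L)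
      = ((List.finRange M).reverse.map fun j => siteOp M (fun _ => L) j).prod := by
    simp [monodromy, List.ofFn_eq_map]
  rw [hprod, hM]
  simp only [Matrix.mul_apply, Fintype.sum_prod_type, siteOp_last, prod_siteOp_castSucc, sum_snoc,
    Fin.init_snoc, Fin.snoc_last]
  refine Finset.sum_congr rfl fun a _ => ?_
  rw [Finset.sum_eq_single (t (Fin.last M)), Finset.sum_eq_single (Fin.init s)]
  · simp
  · intro r _ hr
    simp [hr.symm]
  · simp
  · intro b _ hb
    simp [hb]
  · simp

/-- The action of the blocks `B` (for `i = 0`) and `D` (for `i = 1`) of the monodromy matrix. -/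
def blockAct (M : ℕ) (L : Matrix (Fin 2 × Fin 2) (Fin 2 × Fin 2) ℂ) (i : Fin 2)
    (F : (Fin M → Fin 2) → ℂ) (s : Fin M → Fin 2) : ℂ :=
  ∑ t, monodromy M (fun _ => L) (i, s) (1, t) * F t

lemma blockAct_zero (L : Matrix (Fin 2 × Fin 2) (Fin 2 × Fin 2) ℂ) (i : Fin 2)
    (F : (Fin 0 → Fin 2) → ℂ) (s : Fin 0 → Fin 2) :
    blockAct 0 L i F s = if i = 1 then F s else 0 := by
  rw [blockAct, Fintype.sum_subsingleton _ s, monodromy_zero]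
  simp [Matrix.one_apply]

lemma blockAct_succ {M : ℕ} (L : Matrix (Fin 2 × Fin 2) (Fin 2 × Fin 2) ℂ) (i : Fin 2)
    (F : (Fin (M + 1) → Fin 2) → ℂ) (s : Fin (M + 1) → Fin 2) :
    blockAct (M + 1) L i F s = ∑ a, ∑ b, L (i, s (Fin.last M)) (a, b)
      * blockAct M L a (fun t => F (Fin.snoc t b)) (Fin.init s) := by
  simp only [blockAct, monodromy_succ, sum_snoc, Fin.init_snoc, Fin.snoc_last, Finset.sum_mul,
    Finset.mul_sum]
  conv_rhs => rw [Finset.sum_comm]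
  refine Finset.sum_congr rfl fun b _ => Finset.sum_comm.trans ?_
  exact Finset.sum_congr rfl fun a _ => Finset.sum_congr rfl fun t _ => mul_assoc _ _ _

lemma blockAct_sum {ι : Type*} {M : ℕ} (L : Matrix (Fin 2 × Fin 2) (Fin 2 × Fin 2) ℂ) (i : Fin 2)
    (S : Finset ι) (c : ι → ℂ) (F : ι → (Fin M → Fin 2) → ℂ) (s : Fin M → Fin 2) :
    blockAct M L i (fun t => ∑ m ∈ S, c m * F m t) s = ∑ m ∈ S, c m * blockAct M L i (F m) s := by
  simp only [blockAct, Finset.mul_sum]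
  rw [Finset.sum_comm]
  exact Finset.sum_congr rfl fun m _ => Finset.sum_congr rfl fun t _ => by ring

lemma blockAct_smul {M : ℕ} (L : Matrix (Fin 2 × Fin 2) (Fin 2 × Fin 2) ℂ) (i : Fin 2)
    (c : ℂ) (F : (Fin M → Fin 2) → ℂ) (s : Fin M → Fin 2) :
    blockAct M L i (fun t => c * F t) s = c * blockAct M L i F s := by
  simp only [blockAct, Finset.mul_sum]
  exact Finset.sum_congr rfl fun t _ => by ring

end Monodromy

section Vector

variable {ι : Type*} [DecidableEq ι] (q β : ℂ) (u : ι → ℂ)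

/-- The amplitude for the rightmost particle of `M + 1` sites to sit at the last site with
spectral parameter `u m`, the others carrying the parameters indexed by `T`. -/
def lastAmp (M : ℕ) (m : ι) (T : Finset ι) : ℂ :=
  (1 - q) * wtD β (u m) ^ M * ∏ k ∈ T, (wtA q β (u k) * exchF q (u k) (u m))

/-- The Bethe vector with spectral parameters indexed by `S`, by recursion on the last site. -/
def betheVec : (M : ℕ) → Finset ι → (Fin M → Fin 2) → ℂ
  | 0, S, _ => if S = ∅ then 1 else 0
  | M + 1, S, s =>
    if s (Fin.last M) = 0 then (∏ k ∈ S, wtA q β (u k)) * betheVec M S (Fin.init s)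
    else ∑ m ∈ S, lastAmp q β u M m (S.erase m) * betheVec M (S.erase m) (Fin.init s)

variable {M : ℕ}

lemma betheVec_snoc_zero (S : Finset ι) (t : Fin M → Fin 2) :
    betheVec q β u (M + 1) S (Fin.snoc t (0 : Fin 2))
      = (∏ k ∈ S, wtA q β (u k)) * betheVec q β u M S t := by
  simp [betheVec]

lemma betheVec_snoc_one (S : Finset ι) (t : Fin M → Fin 2) :
    betheVec q β u (M + 1) S (Fin.snoc t (1 : Fin 2))
      = ∑ m ∈ S, lastAmp q β u M m (S.erase m) * betheVec q β u M (S.erase m) t := by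
  simp [betheVec]

lemma betheVec_insert_snoc_one {v : ι} {T : Finset ι} (hv : v ∉ T) (t : Fin M → Fin 2) :
    betheVec q β u (M + 1) (insert v T) (Fin.snoc t (1 : Fin 2))
      = lastAmp q β u M v T * betheVec q β u M T t
        + ∑ m ∈ T, lastAmp q β u M m (insert v (T.erase m))
            * betheVec q β u M (insert v (T.erase m)) t := by
  rw [betheVec_snoc_one, sum_insert hv, erase_insert hv]
  congr 1
  refine sum_congr rfl fun m hm => ?_
  rw [erase_insert_of_ne (ne_of_mem_of_not_mem hm hv).symm]

lemma betheVec_empty (s : Fin M → Fin 2) :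
    betheVec q β u M ∅ s = if s = fun _ => 0 then 1 else 0 := by
  induction M with
  | zero => simp [betheVec, Subsingleton.elim s fun _ => 0]
  | succ M ih =>
    have key : (s = fun _ => 0) ↔ s (Fin.last M) = 0 ∧ Fin.init s = fun _ => 0 := by
      rw [funext_iff, Fin.forall_fin_succ', funext_iff, and_comm]
      rfl
    simp [betheVec, ih, key, ite_and]

lemma lastAmp_insert {v m : ι} {T : Finset ι} (hv : v ∉ T) :
    lastAmp q β u M m (insert v T)
      = wtA q β (u v) * exchF q (u v) (u m) * lastAmp q β u M m T := by
  rw [lastAmp, prod_insert hv, lastAmp]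
  ring

/-- The right-hand side of the action of `D` on a Bethe vector. -/
def dAction (M : ℕ) (v : ι) (S : Finset ι) (s : Fin M → Fin 2) : ℂ :=
  wtD β (u v) ^ M * (∏ k ∈ S, exchF q (u k) (u v)) * betheVec q β u M S s
    + ∑ k ∈ S, wtD β (u k) ^ M * exchG q (u v) (u k) * (∏ l ∈ S.erase k, exchF q (u l) (u k))
        * betheVec q β u M (insert v (S.erase k)) s

lemma blockAct_LXXZb_zero_snoc_zero (v : ℂ) (F : (Fin (M + 1) → Fin 2) → ℂ) (t : Fin M → Fin 2) :
    blockAct (M + 1) (LXXZb q β v) 0 F (Fin.snoc t (0 : Fin 2))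
      = wtA q β v * blockAct M (LXXZb q β v) 0 (fun t => F (Fin.snoc t (0 : Fin 2))) t := by
  simp [blockAct_succ, Fin.sum_univ_two, LXXZb, toPair, pidx, wtA]

lemma blockAct_LXXZb_zero_snoc_one (v : ℂ) (F : (Fin (M + 1) → Fin 2) → ℂ) (t : Fin M → Fin 2) :
    blockAct (M + 1) (LXXZb q β v) 0 F (Fin.snoc t (1 : Fin 2))
      = wtB q β v * blockAct M (LXXZb q β v) 0 (fun t => F (Fin.snoc t (1 : Fin 2))) t
        + (1 - q) * blockAct M (LXXZb q β v) 1 (fun t => F (Fin.snoc t (0 : Fin 2))) t := by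
  simp [blockAct_succ, Fin.sum_univ_two, LXXZb, toPair, pidx, wtB]

lemma blockAct_LXXZb_one_snoc_zero (v : ℂ) (F : (Fin (M + 1) → Fin 2) → ℂ) (t : Fin M → Fin 2) :
    blockAct (M + 1) (LXXZb q β v) 1 F (Fin.snoc t (0 : Fin 2))
      = (1 - q) * blockAct M (LXXZb q β v) 0 (fun t => F (Fin.snoc t (1 : Fin 2))) t
        + wtD β v * blockAct M (LXXZb q β v) 1 (fun t => F (Fin.snoc t (0 : Fin 2))) t := by
  simp [blockAct_succ, Fin.sum_univ_two, LXXZb, toPair, pidx, wtD]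

lemma blockAct_LXXZb_one_snoc_one (v : ℂ) (F : (Fin (M + 1) → Fin 2) → ℂ) (t : Fin M → Fin 2) :
    blockAct (M + 1) (LXXZb q β v) 1 F (Fin.snoc t (1 : Fin 2))
      = wtE q β v * blockAct M (LXXZb q β v) 1 (fun t => F (Fin.snoc t (1 : Fin 2))) t := by
  simp [blockAct_succ, Fin.sum_univ_two, LXXZb, toPair, pidx, wtE]

lemma sum_erase_eq_of_symm (S : Finset ι) (X Y : ι → ι → ℂ)
    (h : ∀ m ∈ S, ∀ k ∈ S, m ≠ k → X m k + X k m = Y m k + Y k m) :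
    ∑ m ∈ S, ∑ k ∈ S.erase m, X m k = ∑ m ∈ S, ∑ k ∈ S.erase m, Y m k := by
  have swap : ∀ Z : ι → ι → ℂ,
      ∑ m ∈ S, ∑ k ∈ S.erase m, Z m k = ∑ m ∈ S, ∑ k ∈ S.erase m, Z k m := fun Z =>
    sum_comm' (by intro a b; simp only [mem_erase]; tauto)
  have double : ∑ m ∈ S, ∑ k ∈ S.erase m, (X m k + X k m)
      = ∑ m ∈ S, ∑ k ∈ S.erase m, (Y m k + Y k m) :=
    sum_congr rfl fun m hm => sum_congr rfl fun k hk =>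
      h m hm k (mem_of_mem_erase hk) (ne_of_mem_erase hk).symm
  simp only [sum_add_distrib] at double
  rw [← swap X, ← swap Y] at double
  linear_combination double / 2

variable {q β u}

/-- `B` adds a spectral parameter to a Bethe vector, and `D` acts by the exchange formula. -/
theorem blockAct_betheVec (hβ : β ≠ 0) (hu : ∀ j, u j ≠ 0)
    (hsq : ∀ j k, j ≠ k → u j ^ 2 ≠ u k ^ 2) (v : ι) (S : Finset ι) (hv : v ∉ S)
    (s : Fin M → Fin 2) :
    blockAct M (LXXZb q β (u v)) 0 (betheVec q β u M S) s = betheVec q β u M (insert v S) s ∧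
    blockAct M (LXXZb q β (u v)) 1 (betheVec q β u M S) s = dAction q β u M v S s := by
  induction M generalizing S with
  | zero =>
    rw [blockAct_zero, blockAct_zero]
    rcases S.eq_empty_or_nonempty with rfl | hS
    · simp [betheVec, dAction]
    · simp [betheVec, dAction, hS.ne_empty]
  | succ M ih =>
    have hne : ∀ m ∈ S, m ≠ v := fun m hm h => hv (h ▸ hm)
    have hve : ∀ m, v ∉ S.erase m := fun m h => hv (mem_of_mem_erase h)
    obtain ⟨t, b, rfl⟩ : ∃ (t : Fin M → Fin 2) (b : Fin 2), s = Fin.snoc t b :=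
      ⟨Fin.init s, s (Fin.last M), (Fin.snoc_init_self s).symm⟩
    have hb : b = 0 ∨ b = 1 := by omega
    rcases hb with rfl | rfl
    · rw [blockAct_LXXZb_zero_snoc_zero, blockAct_LXXZb_one_snoc_zero]
      simp only [betheVec_snoc_zero, betheVec_snoc_one, blockAct_sum, blockAct_smul, dAction,
        (ih S hv t).1, (ih S hv t).2, (ih _ (hve _) t).1, prod_insert hv]
      refine ⟨by ring, ?_⟩
      simp only [mul_add, mul_sum]
      rw [add_left_comm, ← sum_add_distrib]
      congr 1
      · ring
      · refine sum_congr rfl fun m hm => ?_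
        rw [prod_insert (hve m), ← mul_prod_erase S _ hm, lastAmp, prod_mul_distrib]
        linear_combination wtD β (u m) ^ M * (∏ k ∈ S.erase m, wtA q β (u k))
          * (∏ k ∈ S.erase m, exchF q (u k) (u m)) * betheVec q β u M (insert v (S.erase m)) t
          * sq_add_wtD_mul_wtA_mul_exchG (q := q) hβ (hu m) (hu v) (hsq m v (hne m hm))
    · rw [blockAct_LXXZb_zero_snoc_one, blockAct_LXXZb_one_snoc_one]
      constructor
      · rw [betheVec_insert_snoc_one _ _ _ hv]
        simp only [betheVec_snoc_zero, betheVec_snoc_one, blockAct_sum, blockAct_smul, dAction,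
          (ih S hv t).2, (ih _ (hve _) t).1, lastAmp_insert _ _ _ (hve _)]
        simp only [mul_add, mul_sum]
        rw [add_left_comm, ← sum_add_distrib]
        congr 1
        · rw [lastAmp, prod_mul_distrib]
          ring
        · refine sum_congr rfl fun m hm => ?_
          rw [← mul_prod_erase S _ hm, lastAmp, prod_mul_distrib]
          linear_combination (1 - q) * wtD β (u m) ^ M * (∏ k ∈ S.erase m, wtA q β (u k))
            * (∏ k ∈ S.erase m, exchF q (u k) (u m)) * betheVec q β u M (insert v (S.erase m)) t
            * wtB_add_wtA_mul_exchG (q := q) (β := β) (hu m) (hu v) (hsq m v (hne m hm))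
      · simp only [betheVec_snoc_one, blockAct_sum, dAction, (ih _ (hve _) t).2,
          betheVec_insert_snoc_one _ _ _ (hve _),
          lastAmp_insert _ _ _ (fun h => hv (mem_of_mem_erase (mem_of_mem_erase h)))]
        simp only [mul_add, mul_sum, sum_add_distrib]
        conv_rhs => rw [← add_assoc, ← sum_add_distrib]
        congr 1
        · refine sum_congr rfl fun m hm => ?_
          rw [← mul_prod_erase S _ hm, wtE_eq hβ (hu m) (hu v) (hsq m v (hne m hm))]
          simp only [lastAmp, prod_mul_distrib]
          ring
        · refine sum_erase_eq_of_symm S _ _ fun m hm k hk hmk => ?_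
          have hkm : k ∈ S.erase m := mem_erase.2 ⟨hmk.symm, hk⟩
          have hmk' : m ∈ S.erase k := mem_erase.2 ⟨hmk, hm⟩
          simp only [lastAmp, prod_mul_distrib, ← mul_prod_erase _ _ hkm,
            ← mul_prod_erase _ _ hmk', erase_right_comm (a := k) (b := m)]
          linear_combination (1 - q) * wtD β (u m) ^ M * wtD β (u k) ^ M
            * (∏ l ∈ (S.erase m).erase k, wtA q β (u l))
            * (∏ l ∈ (S.erase m).erase k, exchF q (u l) (u m))
            * (∏ l ∈ (S.erase m).erase k, exchF q (u l) (u k))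
            * betheVec q β u M (insert v ((S.erase m).erase k)) t
            * wtE_mul_exchange (q := q) hβ (hu k) (hu v) (hu m) (hsq k v (hne k hk))
              (hsq m v (hne m hm)) (hsq k m hmk.symm)

lemma prod_Bop_apply_vacuum (hβ : β ≠ 0) (hu : ∀ j, u j ≠ 0)
    (hsq : ∀ j k, j ≠ k → u j ^ 2 ≠ u k ^ 2) (l : List ι) (hl : l.Nodup) (s : Fin M → Fin 2) :
    (l.map fun j => Bop M (fun _ => LXXZb q β (u j))).prod s (fun _ => 0)
      = betheVec q β u M l.toFinset s := by
  induction l generalizing s with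
  | nil => simp [betheVec_empty, Matrix.one_apply]
  | cons v l ih =>
    rw [List.nodup_cons] at hl
    rw [List.map_cons, List.prod_cons, Matrix.mul_apply, List.toFinset_cons,
      ← (blockAct_betheVec hβ hu hsq v l.toFinset (by simpa using hl.1) s).1, blockAct]
    exact sum_congr rfl fun t _ => by rw [ih hl.2, Bop, Matrix.of_apply]

end Vector

section CoordinateForm

variable {ι : Type*} (q β : ℂ) (u : ι → ℂ)

/-- The contribution to the wavefunction at positions `x` of one assignment `f` of spectral
parameters to the particles. -/
def coordTerm (M : ℕ) {N : ℕ} (x : Fin N → ℕ) (f : Fin N → ι) : ℂ :=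
  (∏ j, ∏ k, if j < k then exchF q (u (f j)) (u (f k)) else 1)
    * ∏ j, ((1 - q) * wtA q β (u (f j)) ^ M / wtD β (u (f j))
        * (wtD β (u (f j)) / wtA q β (u (f j))) ^ (x j + 1))

lemma coordTerm_succ_sites (M : ℕ) {N : ℕ} (x : Fin N → ℕ) (f : Fin N → ι) :
    coordTerm q β u (M + 1) x f = (∏ j, wtA q β (u (f j))) * coordTerm q β u M x f := by
  rw [coordTerm, coordTerm, mul_left_comm]
  congr 1
  rw [← prod_mul_distrib]
  exact prod_congr rfl fun j _ => by ring

lemma coordTerm_snoc {M N : ℕ} (x : Fin (N + 1) → ℕ) (hx : x (Fin.last N) = M)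
    (ha : ∀ j, wtA q β (u j) ≠ 0) (hd : ∀ j, wtD β (u j) ≠ 0) (g : Fin N → ι) (m : ι) :
    coordTerm q β u (M + 1) x (Fin.snoc g m : Fin (N + 1) → ι)
      = (1 - q) * wtD β (u m) ^ M * (∏ j, (wtA q β (u (g j)) * exchF q (u (g j)) (u m)))
        * coordTerm q β u M (fun j => x j.castSucc) g := by
  have hlast : (1 - q) * wtA q β (u m) ^ (M + 1) / wtD β (u m)
      * (wtD β (u m) / wtA q β (u m)) ^ (M + 1) = (1 - q) * wtD β (u m) ^ M := by
    have := ha m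
    have := hd m
    rw [div_pow]
    field_simp
    ring
  rw [prod_mul_distrib, mul_comm (∏ j, wtA q β (u (g j))), ← mul_assoc, mul_assoc _ (∏ j, _),
    ← coordTerm_succ_sites, coordTerm, coordTerm]
  simp only [Fin.prod_univ_castSucc (n := N), Fin.snoc_castSucc, Fin.snoc_last, hx, hlast,
    Fin.castSucc_lt_castSucc_iff, Fin.castSucc_lt_last, if_true, prod_mul_distrib,
    lt_irrefl, if_false, not_lt_of_gt (Fin.castSucc_lt_last _), prod_const_one, mul_one]
  ring

lemma sum_injective_snoc [DecidableEq ι] [Fintype ι] {N : ℕ} (S : Finset ι) (F : (Fin (N + 1) → ι) → ℂ) :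
    ∑ f : Fin (N + 1) → ι with Function.Injective f ∧ ∀ j, f j ∈ S, F f
      = ∑ m ∈ S, ∑ g : Fin N → ι with Function.Injective g ∧ ∀ j, g j ∈ S.erase m,
          F (Fin.snoc g m) := by
  have key : ∀ (m : ι) (g : Fin N → ι),
      (Function.Injective (Fin.snoc g m : Fin (N + 1) → ι) ∧
        ∀ j, (Fin.snoc g m : Fin (N + 1) → ι) j ∈ S) ↔
      m ∈ S ∧ (Function.Injective g ∧ ∀ j, g j ∈ S.erase m) := by
    intro m g
    rw [Fin.snoc_injective_iff, Fin.forall_fin_succ']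
    simp only [Fin.snoc_castSucc, Fin.snoc_last, mem_erase, Set.mem_range, not_exists]
    constructor
    · rintro ⟨⟨h1, h2⟩, h3, h4⟩
      exact ⟨h4, h1, fun j => ⟨h2 j, h3 j⟩⟩
    · rintro ⟨h4, h1, h⟩
      exact ⟨⟨h1, fun j => (h j).1⟩, fun j => (h j).2, h4⟩
  rw [sum_filter, ← (Fin.snocEquiv (fun _ : Fin (N + 1) => ι)).sum_comp, Fintype.sum_prod_type,
    ← sum_subset (subset_univ S)]
  · refine sum_congr rfl fun m hm => ?_
    rw [sum_filter]
    refine sum_congr rfl fun g _ => if_congr ((key m g).trans (by simp [hm])) rfl rfl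
  · intro m _ hm
    exact sum_eq_zero fun g _ => if_neg fun h => hm ((key m g).1 h).1

variable {q β u}

theorem betheVec_conf [DecidableEq ι] [Fintype ι] (ha : ∀ j, wtA q β (u j) ≠ 0) (hd : ∀ j, wtD β (u j) ≠ 0)
    {M N : ℕ} (x : Fin N → Fin M) (hx : StrictMono x) (S : Finset ι) (hS : S.card = N) :
    betheVec q β u M S (conf x)
      = ∑ f : Fin N → ι with Function.Injective f ∧ ∀ j, f j ∈ S,
          coordTerm q β u M (fun j => (x j : ℕ)) f := by
  induction M generalizing N S with
  | zero =>
    obtain rfl : N = 0 := by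
      rcases N.eq_zero_or_pos with h | h
      · exact h
      · exact (x ⟨0, h⟩).elim0
    rw [card_eq_zero] at hS
    subst hS
    simp [betheVec, coordTerm, Function.injective_of_subsingleton]
  | succ M ih =>
    by_cases hlast : ∃ j, x j = Fin.last M
    · obtain ⟨j, hj⟩ := hlast
      obtain ⟨n, rfl⟩ : ∃ n, N = n + 1 := ⟨N - 1, by have := j.isLt; omega⟩
      have hxl : x (Fin.last n) = Fin.last M :=
        le_antisymm (Fin.le_last _) (hj ▸ hx.monotone (Fin.le_last j))
      have hlt : ∀ i : Fin n, (x i.castSucc : ℕ) < M := fun i => by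
        have := hx (Fin.castSucc_lt_last i)
        rw [hxl] at this
        exact this
      have hconf : conf x = Fin.snoc (conf fun i : Fin n => (⟨x i.castSucc, hlt i⟩ : Fin M))
          (1 : Fin 2) := by
        funext i
        refine Fin.lastCases ?_ (fun i => ?_) i
        · rw [Fin.snoc_last, conf, if_pos ⟨_, hxl⟩]
        · rw [Fin.snoc_castSucc, conf, conf]
          refine if_congr ?_ rfl rfl
          rw [Fin.exists_fin_succ']
          simp [hxl, (Fin.castSucc_ne_last i).symm, Fin.ext_iff]
      rw [hconf, betheVec_snoc_one, sum_injective_snoc]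
      refine sum_congr rfl fun m hm => ?_
      rw [ih (fun i : Fin n => (⟨x i.castSucc, hlt i⟩ : Fin M))
        (fun i j hij => hx (Fin.castSucc_lt_castSucc_iff.2 hij)) (S.erase m)
        (by rw [card_erase_of_mem hm, hS]; rfl), mul_sum]
      refine sum_congr rfl fun g hg => ?_
      simp only [mem_filter, mem_univ, true_and] at hg
      have himg : S.erase m = univ.image g := by
        refine (eq_of_subset_of_card_le ?_ ?_).symm
        · intro k hk
          obtain ⟨j, -, rfl⟩ := mem_image.1 hk
          exact hg.2 j
        · rw [card_image_of_injective _ hg.1, card_erase_of_mem hm, hS]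
          simp
      rw [coordTerm_snoc _ _ _ _ (by rw [hxl]; rfl) ha hd, lastAmp, himg,
        prod_image hg.1.injOn]
    · push Not at hlast
      have hlt : ∀ i : Fin N, (x i : ℕ) < M := fun i => Fin.val_lt_last (hlast i)
      have hconf : conf x = Fin.snoc (conf fun i : Fin N => (⟨x i, hlt i⟩ : Fin M))
          (0 : Fin 2) := by
        funext i
        refine Fin.lastCases ?_ (fun i => ?_) i
        · rw [Fin.snoc_last, conf, if_neg (by simpa using hlast)]
        · rw [Fin.snoc_castSucc, conf, conf]
          refine if_congr ?_ rfl rfl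
          simp [Fin.ext_iff]
      rw [hconf, betheVec_snoc_zero, ih (fun i : Fin N => (⟨x i, hlt i⟩ : Fin M))
        (fun i j hij => hx hij) S hS, mul_sum]
      refine sum_congr rfl fun g hg => ?_
      simp only [mem_filter, mem_univ, true_and] at hg
      have himg : S = univ.image g := by
        refine (eq_of_subset_of_card_le ?_ ?_).symm
        · intro k hk
          obtain ⟨j, -, rfl⟩ := mem_image.1 hk
          exact hg.2 j
        · rw [card_image_of_injective _ hg.1, hS]
          simp
      rw [coordTerm_succ_sites, himg, prod_image hg.1.injOn]

lemma sum_injective_eq_sum_perm {N : ℕ} (F : (Fin N → Fin N) → ℂ) :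
    ∑ f : Fin N → Fin N with Function.Injective f ∧ ∀ j, f j ∈ (univ : Finset (Fin N)), F f
      = ∑ σ : Equiv.Perm (Fin N), F σ := by
  symm
  refine sum_bij (fun σ _ => ⇑σ) ?_ ?_ ?_ ?_
  · intro σ _
    simp [σ.injective]
  · intro σ _ τ _ h
    exact DFunLike.coe_injective h
  · intro f hf
    simp only [mem_filter, mem_univ, true_and, implies_true, and_true] at hf
    exact ⟨Equiv.ofBijective f (Finite.injective_iff_bijective.1 hf), mem_univ _, rfl⟩
  · intro σ _
    rfl

lemma prod_prod_eq_prod_lt {N : ℕ} (h : Fin N → Fin N → ℂ) (hdiag : ∀ j, h j j = 1) :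
    ∏ j, ∏ k, h j k = ∏ j, ∏ k, if j < k then h j k * h k j else 1 := by
  have split : ∀ j k, h j k = (if j < k then h j k else 1) * (if k < j then h j k else 1) := by
    intro j k
    rcases lt_trichotomy j k with hjk | rfl | hjk
    · simp [hjk, hjk.not_gt]
    · simp [hdiag]
    · simp [hjk, hjk.not_gt]
  rw [prod_congr rfl fun j _ => prod_congr rfl fun k _ => split j k]
  simp only [prod_mul_distrib]
  rw [prod_comm (f := fun j k => if k < j then h j k else 1)]
  simp only [← prod_mul_distrib]
  exact prod_congr rfl fun j _ => prod_congr rfl fun k _ => by split_ifs <;> simp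

/-- Permuting the arguments of an ordered product of pair factors produces one ratio for each
inversion. -/
lemma prod_lt_perm {N : ℕ} (σ : Equiv.Perm (Fin N)) (h : Fin N → Fin N → ℂ)
    (hne : ∀ j k, j ≠ k → h j k ≠ 0) :
    (∏ j, ∏ k, if j < k then h (σ j) (σ k) else 1)
      = (∏ j, ∏ k, if j < k then h j k else 1)
        * ∏ j, ∏ k, if j < k ∧ σ k < σ j then h (σ j) (σ k) / h (σ k) (σ j) else 1 := by
  have reindex : (∏ j, ∏ k, if j < k then h j k else 1)
      = ∏ j, ∏ k, if σ j < σ k then h (σ j) (σ k) else 1 := by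
    rw [← Equiv.prod_comp σ]
    exact prod_congr rfl fun j _ => (Equiv.prod_comp σ fun k => if σ j < k then h (σ j) k else 1).symm
  rw [reindex, prod_prod_eq_prod_lt (fun j k => if σ j < σ k then h (σ j) (σ k) else 1)
    fun j => if_neg (lt_irrefl _)]
  simp only [← prod_mul_distrib]
  refine prod_congr rfl fun j _ => prod_congr rfl fun k _ => ?_
  by_cases hjk : j < k
  · rcases lt_or_gt_of_ne (σ.injective.ne hjk.ne) with hσ | hσ
    · simp [hjk, hσ, hσ.not_gt]
    · simp only [hjk, hσ, hσ.not_gt, if_true, if_false, and_self, one_mul]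
      rw [mul_div_cancel₀ _ (hne _ _ hσ.ne)]
  · simp [hjk]

end CoordinateForm

end BetheVector

/-- Explicit form of the wavefunction of the model built from the
`β`-deformed XXZ-type L-operator. Positions are `1`-indexed: site `x_j` is `(x j : ℕ) + 1`. -/
theorem wavefunction_q_beta_grothendieck (β q : ℂ) (hβ : β ≠ 0)
    (M N : ℕ) (hN : 1 ≤ N) (hMN : N ≤ M)
    (u : Fin N → ℂ) (hu0 : ∀ j, u j ≠ 0)
    (hden1 : ∀ j, u j + q * β * (u j)⁻¹ ≠ 0)
    (hden2 : ∀ j, -β⁻¹ * u j - (u j)⁻¹ ≠ 0)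
    (hsq : ∀ j k, j ≠ k → (u j) ^ 2 ≠ (u k) ^ 2)
    (hqsq : ∀ j k, j ≠ k → q * (u j) ^ 2 ≠ (u k) ^ 2)
    (x : Fin N → Fin M) (hx : StrictMono x) :
    ((List.ofFn fun j : Fin N => Bop M (fun _ => LXXZb q β (u j))).prod)
        (conf x) (fun _ => 0)
      = (∏ j, (1 - q) * (u j + q * β * (u j)⁻¹) ^ M / (-β⁻¹ * u j - (u j)⁻¹))
        * (∏ j, ∏ k, if j < k then
            (q - ((u j)⁻¹) ^ 2 * (u k) ^ 2) / (1 - ((u j)⁻¹) ^ 2 * (u k) ^ 2) else 1)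
        * ∑ σ : Equiv.Perm (Fin N),
            (∏ j, ∏ k, if j < k ∧ σ k < σ j then
                (1 - q * (u (σ j)) ^ 2 * ((u (σ k))⁻¹) ^ 2)
                  / (q - (u (σ j)) ^ 2 * ((u (σ k))⁻¹) ^ 2) else 1)
            * ∏ j, ((-β⁻¹ * u (σ j) - (u (σ j))⁻¹)
                  / (u (σ j) + q * β * (u (σ j))⁻¹)) ^ ((x j : ℕ) + 1) := by
  have key := betheVec_conf (q := q) (β := β) (u := u) hden1 hden2 x hx Finset.univ (by simp)
  have hF : ∀ j k, j ≠ k → exchF q (u j) (u k) ≠ 0 := fun j k hjk =>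
    div_ne_zero (sub_ne_zero.2 (hqsq j k hjk)) (sub_ne_zero.2 (hsq j k hjk))
  rw [List.ofFn_eq_map, prod_Bop_apply_vacuum hβ hu0 hsq _ (List.nodup_finRange N),
    List.toFinset_finRange, key, sum_injective_eq_sum_perm, Finset.mul_sum]
  refine Finset.sum_congr rfl fun σ _ => ?_
  rw [coordTerm, prod_lt_perm σ (fun j k => exchF q (u j) (u k)) hF, Finset.prod_mul_distrib,
    Equiv.prod_comp σ (fun j => (1 - q) * wtA q β (u j) ^ M / wtD β (u j))]
  have hpair : (∏ j, ∏ k, if j < k then exchF q (u j) (u k) else 1)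
      = ∏ j, ∏ k, if j < k then
          (q - ((u j)⁻¹) ^ 2 * (u k) ^ 2) / (1 - ((u j)⁻¹) ^ 2 * (u k) ^ 2) else 1 := by
    refine Finset.prod_congr rfl fun j _ => Finset.prod_congr rfl fun k _ =>
      if_ctx_congr Iff.rfl (fun _ => ?_) fun _ => rfl
    have hj := hu0 j
    rw [exchF, ← mul_div_mul_left (q - _) _ (pow_ne_zero 2 hj)]
    congr 1 <;> field_simp
  have hinv : (∏ j, ∏ k, if j < k ∧ σ k < σ j then
        exchF q (u (σ j)) (u (σ k)) / exchF q (u (σ k)) (u (σ j)) else 1)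
      = ∏ j, ∏ k, if j < k ∧ σ k < σ j then
          (1 - q * (u (σ j)) ^ 2 * ((u (σ k))⁻¹) ^ 2)
            / (q - (u (σ j)) ^ 2 * ((u (σ k))⁻¹) ^ 2) else 1 := by
    refine Finset.prod_congr rfl fun j _ => Finset.prod_congr rfl fun k _ =>
      if_ctx_congr Iff.rfl (fun hjk => ?_) fun _ => rfl
    have hk := hu0 (σ k)
    have h1 := sub_ne_zero.2 (hsq (σ j) (σ k) hjk.2.ne')
    have h2 := sub_ne_zero.2 (hqsq (σ k) (σ j) hjk.2.ne)
    have hnum : u (σ k) ^ 2 * (1 - q * u (σ j) ^ 2 * ((u (σ k))⁻¹) ^ 2)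
        = u (σ k) ^ 2 - q * u (σ j) ^ 2 := by
      field_simp
    have hden : u (σ k) ^ 2 * (q - u (σ j) ^ 2 * ((u (σ k))⁻¹) ^ 2)
        = q * u (σ k) ^ 2 - u (σ j) ^ 2 := by
      field_simp
    rw [exchF, exchF, ← mul_div_mul_left (1 - _) _ (pow_ne_zero 2 hk), hnum, hden,
      div_div_div_eq, div_eq_div_iff (mul_ne_zero h1 h2) h2]
    ring
  rw [hpair, hinv]
  simp only [wtA, wtD]
  ring
end
end

section
/- Let p, q ∈ ℂ with p ≠ 0 and 1−p⁻¹qu_j ≠ 0 for all j, let M ≥ N ≥ 1, and let u₁,…,u_N be pairwise distinct complex numbers. Then for any hole positions 1 ≤ x̄₁ < ⋯ < x̄_N ≤ M, the Felderhof model satisfies ⟨1⋯M| B(u₁)⋯B(u_N) |x̄₁⋯x̄_N⟩ = ∏_{j=1}^N (1−q²){−p²(1−p⁻¹qu_j)}^{M−1} · ∏_{1≤j<k≤N} (p²u_k−u_j)/(p²(u_k−u_j)) · det_{1≤j,k≤N}( ((u_j−pq)/(−p²(1−p⁻¹qu_j)))^{x̄_k−1} ). -/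
noncomputable section

/-- The configuration of `V^{⊗M}` with holes (`|0⟩`) at positions `x̄` and `|1⟩` elsewhere. -/
def holeConf {M N : ℕ} (x : Fin N → Fin M) : Fin M → Fin 2 :=
  fun i => if ∃ j, x j = i then 0 else 1

/-- The Felderhof L-operator. -/
def Lfel (u p q : ℂ) : Matrix (Fin 2 × Fin 2) (Fin 2 × Fin 2) ℂ :=
  toPair !![1 - p * q * u, 0, 0, 0;
            0, -p ^ 2 * (1 - p⁻¹ * q * u), 1 - q ^ 2, 0;
            0, (1 - p ^ 2) * u, u - p⁻¹ * q, 0;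
            0, 0, 0, u - p * q]

/-- The partial fraction expansion of `∏ (β - z) / (z - v)`. -/
lemma prod_sub_div_eq_sum {ι : Type*} [DecidableEq ι] (s : Finset ι) (v β : ι → ℂ)
    (hv : Set.InjOn v s) (z : ℂ) (hz : ∀ i ∈ s, z ≠ v i) :
    ∏ i ∈ s, (β i - z) / (z - v i) = (-1) ^ s.card
      + ∑ k ∈ s, (β k - v k) / (z - v k) * ∏ j ∈ s.erase k, (β j - v k) / (v k - v j) := by
  open Polynomial in
  set Q : ℂ[X] := ∏ i ∈ s, (X - C (β i)) - Lagrange.nodal s v with hQ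
  have hdeg : Q.degree < s.card := by
    have h1 : (∏ i ∈ s, (X - C (β i))).degree = (s.card : WithBot ℕ) := by simp [degree_prod]
    have h2 : (Lagrange.nodal s v).degree = s.card := Lagrange.degree_nodal
    rw [← h1]
    refine degree_sub_lt_left (by rw [h1, h2]) ?_ ?_
    · exact (monic_prod_of_monic _ _ fun i _ => monic_X_sub_C _).ne_zero
    · rw [(monic_prod_of_monic _ _ fun i _ => monic_X_sub_C _).leadingCoeff,
        Lagrange.nodal_monic.leadingCoeff]
  have hI := Lagrange.eq_interpolate hv hdeg
  have hz' := congrArg (eval z) hI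
  rw [Lagrange.eval_interpolate_not_at_node _ hz] at hz'
  have hN : (∏ i ∈ s, (z - v i)) ≠ 0 :=
    Finset.prod_ne_zero_iff.2 fun i hi => sub_ne_zero.2 (hz i hi)
  simp only [hQ, eval_sub, eval_prod, eval_X, eval_C, Lagrange.eval_nodal] at hz'
  have key : ∏ i ∈ s, (z - β i) / (z - v i) = 1
      + ∑ k ∈ s, Lagrange.nodalWeight s v k * (z - v k)⁻¹ * ∏ i ∈ s, (v k - β i) := by
    rw [Finset.prod_div_distrib, div_eq_iff hN, add_mul, one_mul, ← sub_eq_iff_eq_add', hz',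
      mul_comm]
    congr 1
    refine Finset.sum_congr rfl fun k hk => ?_
    rw [Finset.prod_eq_zero (f := fun i => v k - v i) hk (sub_self _), sub_zero]
  have e1 : ∏ i ∈ s, (β i - z) / (z - v i) = (-1) ^ s.card * ∏ i ∈ s, (z - β i) / (z - v i) := by
    rw [← Finset.prod_const, ← Finset.prod_mul_distrib]
    exact Finset.prod_congr rfl fun i _ => by ring
  rw [e1, key, mul_add, mul_one, Finset.mul_sum]
  congr 1
  refine Finset.sum_congr rfl fun k hk => ?_
  have e2 : ∏ i ∈ s, (v k - β i) = (-1) ^ s.card * ∏ i ∈ s, (β i - v k) := by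
    rw [← Finset.prod_const, ← Finset.prod_mul_distrib]
    exact Finset.prod_congr rfl fun i _ => by ring
  have e3 : ((-1 : ℂ) ^ s.card) * (-1) ^ s.card = 1 := by
    rw [← mul_pow]; simp
  rw [e2, ← Finset.mul_prod_erase s (fun i => β i - v k) hk, Finset.prod_div_distrib,
    Lagrange.nodalWeight, Finset.prod_inv_distrib]
  linear_combination ((∏ j ∈ s.erase k, (v k - v j))⁻¹ * (z - v k)⁻¹ * ((β k - v k) *
    ∏ j ∈ s.erase k, (β j - v k))) * e3

/-- The scalar identity behind the exchange of the operators `B` and `D`. -/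
lemma sum_residue_add_prod_eq (p q : ℂ) (hp : p ≠ 0) (n : ℕ) (v : Fin (n + 1) → ℂ)
    (hv : Function.Injective v) (hden : ∀ j, 1 - p⁻¹ * q * v j ≠ 0) (z : ℂ)
    (hz : ∀ j, z ≠ v j) :
    ∑ k, (-p ^ 2 * (1 - p⁻¹ * q * z)) * ((p ^ 2 - 1) * v k / (p ^ 2 * (z - v k)))
        * ∏ i, (-p ^ 2 * (1 - p⁻¹ * q * v (k.succAbove i)))
          * ((p ^ 2 * v (k.succAbove i) - v k) / (p ^ 2 * (v k - v (k.succAbove i))))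
      + ∏ i, (1 - p * q * v i)
      = ∏ i, (-p ^ 2 * (1 - p⁻¹ * q * v i)) * ((p ^ 2 * v i - z) / (p ^ 2 * (z - v i))) := by
  have hz' : ∀ j, z - v j ≠ 0 := fun j => sub_ne_zero.2 (hz j)
  have hP := fun w hw => prod_sub_div_eq_sum Finset.univ v (fun i => p ^ 2 * v i) hv.injOn w hw
  have her : ∀ (k : Fin (n + 1)) (f : Fin (n + 1) → ℂ),
      ∏ j ∈ Finset.univ.erase k, f j = ∏ i, f (k.succAbove i) := by
    intro k f
    rw [← Finset.compl_singleton, ← Fin.image_succAbove_univ,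
      Finset.prod_image (fun a _ b _ h => Fin.succAbove_right_injective h)]
  simp only [her, Finset.card_univ, Fintype.card_fin] at hP
  set A : ℂ := ∏ i, (1 - p⁻¹ * q * v i) with hA
  have hR : ∏ i, (-p ^ 2 * (1 - p⁻¹ * q * v i)) * ((p ^ 2 * v i - z) / (p ^ 2 * (z - v i)))
      = (-1) ^ (n + 1) * A * ∏ i, (p ^ 2 * v i - z) / (z - v i) := by
    have : ((-1 : ℂ)) ^ (n + 1) = ∏ _i : Fin (n + 1), (-1 : ℂ) := by simp
    rw [this, hA, ← Finset.prod_mul_distrib, ← Finset.prod_mul_distrib]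
    refine Finset.prod_congr rfl fun i _ => ?_
    have := hz' i
    field_simp
  have hL : ∀ k, (-p ^ 2 * (1 - p⁻¹ * q * z)) * ((p ^ 2 - 1) * v k / (p ^ 2 * (z - v k)))
        * ∏ i, (-p ^ 2 * (1 - p⁻¹ * q * v (k.succAbove i)))
          * ((p ^ 2 * v (k.succAbove i) - v k) / (p ^ 2 * (v k - v (k.succAbove i))))
      = (-1) ^ (n + 1) * A * ((1 - p⁻¹ * q * z) / (1 - p⁻¹ * q * v k)
        * ((p ^ 2 * v k - v k) / (z - v k)
        * ∏ i, (p ^ 2 * v (k.succAbove i) - v k) / (v k - v (k.succAbove i)))) := by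
    intro k
    have h1 : ∏ i, (-p ^ 2 * (1 - p⁻¹ * q * v (k.succAbove i)))
          * ((p ^ 2 * v (k.succAbove i) - v k) / (p ^ 2 * (v k - v (k.succAbove i))))
        = (-1) ^ n * (∏ i, (1 - p⁻¹ * q * v (k.succAbove i))) *
          ∏ i, (p ^ 2 * v (k.succAbove i) - v k) / (v k - v (k.succAbove i)) := by
      have : ((-1 : ℂ)) ^ n = ∏ _i : Fin n, (-1 : ℂ) := by simp
      rw [this, ← Finset.prod_mul_distrib, ← Finset.prod_mul_distrib]
      refine Finset.prod_congr rfl fun i _ => ?_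
      have := sub_ne_zero.2 (hv.ne (Fin.succAbove_ne k i).symm)
      field_simp
    rw [h1, hA, Fin.prod_univ_succAbove _ k]
    have e1 := hz' k
    have e2 := hden k
    generalize (∏ i, (1 - p⁻¹ * q * v (k.succAbove i))) = X
    generalize ∏ i, (p ^ 2 * v (k.succAbove i) - v k) / (v k - v (k.succAbove i)) = Y
    generalize 1 - p⁻¹ * q * v k = b at *
    generalize 1 - p⁻¹ * q * z = b'
    field_simp
    ring
  rw [hR, Finset.sum_congr rfl fun k _ => hL k, ← Finset.mul_sum, hP z fun i _ => hz i]
  by_cases hq : q = 0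
  · subst hq
    have e : ((-1 : ℂ) ^ (n + 1)) * (-1) ^ (n + 1) = 1 := by rw [← mul_pow]; simp
    simp only [hA, mul_zero, zero_mul, sub_zero, Finset.prod_const_one, div_one, one_mul, mul_one]
    rw [mul_add, e, add_comm]
  · have hw : ∀ i, p / q ≠ v i := by
      intro i h
      apply hden i
      rw [← h]; field_simp; simp
    have hw0 := hP (p / q) fun i _ => hw i
    have hr : ∏ i, (1 - p * q * v i)
        = (-1) ^ (n + 1) * A * ∏ i, (p ^ 2 * v i - p / q) / (p / q - v i) := by
      have : ((-1 : ℂ)) ^ (n + 1) = ∏ _i : Fin (n + 1), (-1 : ℂ) := by simp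
      rw [this, hA, ← Finset.prod_mul_distrib, ← Finset.prod_mul_distrib]
      refine Finset.prod_congr rfl fun i _ => ?_
      have := sub_ne_zero.2 (hw i)
      have h2 : 1 - p⁻¹ * q * v i = p⁻¹ * q * (p / q - v i) := by field_simp
      have h3 : p ^ 2 * v i - p / q = -(p / q) * (1 - p * q * v i) := by field_simp; ring
      rw [h2, h3]
      generalize p / q - v i = b at *
      field_simp
    rw [hr, hw0, ← mul_add]
    congr 1
    rw [add_left_comm, ← Finset.sum_add_distrib]
    congr 1
    refine Finset.sum_congr rfl fun k _ => ?_
    rw [← mul_assoc, ← add_mul]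
    congr 1
    have h1 := sub_ne_zero.2 (hw k)
    have h2 : 1 - p⁻¹ * q * v k = p⁻¹ * q * (p / q - v k) := by field_simp
    have h3 : 1 - p⁻¹ * q * z = p⁻¹ * q * (p / q - z) := by field_simp
    have h4 := hz' k
    rw [h2, h3]
    have h5 : p / q - z = (p / q - v k) - (z - v k) := by ring
    rw [h5]
    generalize p / q - v k = b at *
    generalize z - v k = b' at *
    field_simp
    ring

section Algebra

variable {𝒜 : Type*} [Ring 𝒜] [Algebra ℂ 𝒜]

/-- Moving one `B` to the front of an ordered product of `B`s. -/
lemma smul_mul_prod_succAbove (p : ℂ) (B : ℂ → 𝒜)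
    (hBB : ∀ u v, (p ^ 2 * u - v) • (B u * B v) = (p ^ 2 * v - u) • (B v * B u))
    (n : ℕ) (u : Fin (n + 1) → ℂ) (k : Fin (n + 1)) :
    (∏ i, if k.succAbove i < k then p ^ 2 * u k - u (k.succAbove i)
        else p ^ 2 * u (k.succAbove i) - u k)
        • (B (u k) * (List.ofFn fun i => B (u (k.succAbove i))).prod)
      = (∏ i, (p ^ 2 * u (k.succAbove i) - u k)) • (List.ofFn fun i => B (u i)).prod := by
  induction n with
  | zero =>
    obtain rfl : k = 0 := Fin.fin_one_eq_zero k
    simp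
  | succ n ih =>
    induction k using Fin.cases with
    | zero => simp [List.ofFn_succ]
    | succ k =>
      have h := ih (fun i => u i.succ) k
      rw [Fin.prod_univ_succ, Fin.prod_univ_succ, List.ofFn_succ (f := fun i => B (u i)),
        List.ofFn_succ]
      simp only [Fin.succ_succAbove_succ, Fin.succ_succAbove_zero, Fin.succ_lt_succ_iff,
        Fin.succ_pos, if_true, List.prod_cons]
      rw [← mul_assoc, mul_smul, smul_comm, ← smul_mul_assoc, hBB, smul_mul_assoc, smul_comm,
        mul_assoc, ← mul_smul_comm, h, mul_smul_comm, ← mul_smul]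

/-- The coefficient of `D (u k)` after moving every `D` to the front. -/
def exchangeCoeff (p q : ℂ) {n : ℕ} (u : Fin (n + 1) → ℂ) (k : Fin (n + 1)) : ℂ :=
  ∏ i, (-p ^ 2 * (1 - p⁻¹ * q * u (k.succAbove i)))
    * ((if k.succAbove i < k then p ^ 2 * u k - u (k.succAbove i)
        else p ^ 2 * u (k.succAbove i) - u k) / (p ^ 2 * (u k - u (k.succAbove i))))

lemma exchangeCoeff_zero (p q : ℂ) {n : ℕ} (u : Fin (n + 1) → ℂ) :
    exchangeCoeff p q u 0 = ∏ i : Fin n, (-p ^ 2 * (1 - p⁻¹ * q * u i.succ))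
      * ((p ^ 2 * u i.succ - u 0) / (p ^ 2 * (u 0 - u i.succ))) := by
  simp [exchangeCoeff]

lemma exchangeCoeff_succ (p q : ℂ) {n : ℕ} (u : Fin (n + 2) → ℂ) (k : Fin (n + 1)) :
    exchangeCoeff p q u k.succ = (-p ^ 2 * (1 - p⁻¹ * q * u 0))
      * ((p ^ 2 * u k.succ - u 0) / (p ^ 2 * (u k.succ - u 0)))
      * exchangeCoeff p q (fun i => u i.succ) k := by
  simp only [exchangeCoeff, Fin.prod_univ_succ, Fin.succ_succAbove_succ, Fin.succ_succAbove_zero,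
    Fin.succ_lt_succ_iff, Fin.succ_pos, if_true]

/-- The recursion generating the ordered products with a single `D` is solved by moving `D`
to the front. -/
lemma exchange_sum_succ (p q : ℂ) (hp : p ≠ 0) (B D : ℂ → 𝒜)
    (hBB : ∀ u v, (p ^ 2 * u - v) • (B u * B v) = (p ^ 2 * v - u) • (B v * B u))
    (hBD : ∀ u v, (p ^ 2 * (v - u)) • (B u * D v) + ((p ^ 2 - 1) * v) • (D u * B v)
      = (p ^ 2 * v - u) • (D v * B u))
    (n : ℕ) (u : Fin (n + 2) → ℂ) (hu : Function.Injective u)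
    (hden : ∀ j, 1 - p⁻¹ * q * u j ≠ 0) :
    (-p ^ 2 * (1 - p⁻¹ * q * u 0)) • (B (u 0) *
        ∑ k : Fin (n + 1), exchangeCoeff p q (fun i => u i.succ) k •
          (D (u k.succ) * (List.ofFn fun i => B (u (k.succAbove i).succ)).prod))
      + (∏ i : Fin (n + 1), (1 - p * q * u i.succ)) •
        (D (u 0) * (List.ofFn fun i : Fin (n + 1) => B (u i.succ)).prod)
      = ∑ k, exchangeCoeff p q u k •
          (D (u k) * (List.ofFn fun i => B (u (k.succAbove i))).prod) := by
  have hne : ∀ k : Fin (n + 1), u k.succ - u 0 ≠ 0 := fun k =>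
    sub_ne_zero.2 (hu.ne (Fin.succ_ne_zero k))
  have hBD' : ∀ k : Fin (n + 1), B (u 0) * D (u k.succ)
      = ((p ^ 2 * u k.succ - u 0) / (p ^ 2 * (u k.succ - u 0))) • (D (u k.succ) * B (u 0))
        + ((p ^ 2 - 1) * u k.succ / (p ^ 2 * (u 0 - u k.succ))) • (D (u 0) * B (u k.succ)) := by
    intro k
    have h := hBD (u 0) (u k.succ)
    have h0 : p ^ 2 * (u k.succ - u 0) ≠ 0 := mul_ne_zero (pow_ne_zero _ hp) (hne k)
    rw [← eq_sub_iff_add_eq] at h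
    have h' := congrArg (fun X => (p ^ 2 * (u k.succ - u 0))⁻¹ • X) h
    simp only [smul_smul, inv_mul_cancel₀ h0, one_smul, smul_sub] at h'
    rw [h', sub_eq_add_neg, ← neg_smul]
    congr 2
    · ring
    · rw [← neg_sub (u k.succ) (u 0), mul_neg, div_neg]; ring
  have hmove : ∀ k : Fin (n + 1), exchangeCoeff p q (fun i => u i.succ) k •
      (B (u k.succ) * (List.ofFn fun i => B (u (k.succAbove i).succ)).prod)
      = (∏ i, (-p ^ 2 * (1 - p⁻¹ * q * u (k.succAbove i).succ))
          * ((p ^ 2 * u (k.succAbove i).succ - u k.succ)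
            / (p ^ 2 * (u k.succ - u (k.succAbove i).succ))))
        • (List.ofFn fun i : Fin (n + 1) => B (u i.succ)).prod := by
    intro k
    have h := smul_mul_prod_succAbove p B hBB n (fun i => u i.succ) k
    have h' := congrArg (fun X => (∏ i, (-p ^ 2 * (1 - p⁻¹ * q * u (k.succAbove i).succ))
      / (p ^ 2 * (u k.succ - u (k.succAbove i).succ))) • X) h
    simp only [smul_smul, ← Finset.prod_mul_distrib] at h'
    convert h' using 2
    · exact Finset.prod_congr rfl fun i _ => by ring
    · exact Finset.prod_congr rfl fun i _ => by ring
  have hterm : ∀ k : Fin (n + 1), (-p ^ 2 * (1 - p⁻¹ * q * u 0)) • (B (u 0) *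
      (exchangeCoeff p q (fun i => u i.succ) k •
          (D (u k.succ) * (List.ofFn fun i => B (u (k.succAbove i).succ)).prod)))
      = exchangeCoeff p q u k.succ •
          (D (u k.succ) * (List.ofFn fun i => B (u (k.succ.succAbove i))).prod)
        + ((-p ^ 2 * (1 - p⁻¹ * q * u 0))
            * ((p ^ 2 - 1) * u k.succ / (p ^ 2 * (u 0 - u k.succ)))
          * ∏ i, (-p ^ 2 * (1 - p⁻¹ * q * u (k.succAbove i).succ))
          * ((p ^ 2 * u (k.succAbove i).succ - u k.succ)
            / (p ^ 2 * (u k.succ - u (k.succAbove i).succ))))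
          • (D (u 0) * (List.ofFn fun i : Fin (n + 1) => B (u i.succ)).prod) := by
    intro k
    rw [mul_smul_comm, ← mul_assoc, hBD', add_mul, smul_add, smul_add, exchangeCoeff_succ,
      List.ofFn_succ]
    simp only [Fin.succ_succAbove_succ, Fin.succ_succAbove_zero, List.prod_cons]
    congr 1
    · rw [smul_mul_assoc, mul_assoc (D _), smul_smul, smul_smul]
      congr 1; ring
    · rw [smul_mul_assoc, mul_assoc (D _), smul_comm (exchangeCoeff p q (fun i => u i.succ) k),
        ← mul_smul_comm (exchangeCoeff p q (fun i => u i.succ) k) (D _), hmove,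
        mul_smul_comm, smul_smul, smul_smul]
  rw [Finset.mul_sum, Finset.smul_sum, Finset.sum_congr rfl fun k _ => hterm k,
    Finset.sum_add_distrib, ← Finset.sum_smul, add_assoc, ← add_smul,
    sum_residue_add_prod_eq p q hp n (fun i => u i.succ)
      (hu.comp (Fin.succ_injective _)) (fun j => hden _) (u 0)
      (fun j => hu.ne (Fin.succ_ne_zero j).symm),
    Fin.sum_univ_succ (n := n + 1), exchangeCoeff_zero]
  simp only [Fin.succAbove_zero]
  rw [add_comm]

/-- The expansion of a product of `B`-operators with one site split off. The elements `n₁`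
and `σ` stand for the matrix units `|1⟩⟨1|` and `|1⟩⟨0|` of that site. -/
lemma mul_prod_split (p q c : ℂ) (hp : p ≠ 0) (B D B' : ℂ → 𝒜) (n₁ σ : 𝒜)
    (hBB : ∀ u v, (p ^ 2 * u - v) • (B u * B v) = (p ^ 2 * v - u) • (B v * B u))
    (hBD : ∀ u v, (p ^ 2 * (v - u)) • (B u * D v) + ((p ^ 2 - 1) * v) • (D u * B v)
      = (p ^ 2 * v - u) • (D v * B u))
    (h₁ : ∀ u, n₁ * B' u = (-p ^ 2 * (1 - p⁻¹ * q * u)) • (B u * n₁) + c • (D u * σ))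
    (h₀ : ∀ u, σ * B' u = (1 - p * q * u) • (B u * σ))
    (n : ℕ) (u : Fin (n + 1) → ℂ) (hu : Function.Injective u)
    (hden : ∀ j, 1 - p⁻¹ * q * u j ≠ 0) :
    n₁ * (List.ofFn fun i => B' (u i)).prod
      = (∏ i, (-p ^ 2 * (1 - p⁻¹ * q * u i))) • ((List.ofFn fun i => B (u i)).prod * n₁)
        + c • ((∑ k, exchangeCoeff p q u k •
          (D (u k) * (List.ofFn fun i => B (u (k.succAbove i))).prod)) * σ) := by
  have hσ : ∀ (m : ℕ) (w : Fin m → ℂ), σ * (List.ofFn fun i => B' (w i)).prod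
      = (∏ i, (1 - p * q * w i)) • ((List.ofFn fun i => B (w i)).prod * σ) := by
    intro m
    induction m with
    | zero => simp
    | succ m ih =>
      intro w
      rw [List.ofFn_succ, List.ofFn_succ, List.prod_cons, List.prod_cons, ← mul_assoc, h₀,
        smul_mul_assoc, mul_assoc (B _), ih, Fin.prod_univ_succ, mul_smul_comm, smul_smul,
        mul_assoc (B _)]
  induction n with
  | zero => simp [h₁, exchangeCoeff]
  | succ n ih =>
    rw [List.ofFn_succ, List.prod_cons, ← mul_assoc, h₁, add_mul, smul_mul_assoc, mul_assoc (B _),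
      ih (fun i => u i.succ) (hu.comp (Fin.succ_injective _)) (fun j => hden _),
      smul_mul_assoc, mul_assoc (D _), hσ,
      ← exchange_sum_succ p q hp B D hBB hBD n u hu hden,
      List.ofFn_succ (f := fun i => B (u i)), List.prod_cons,
      Fin.prod_univ_succ (n := n + 1)]
    simp only [mul_add, add_mul, smul_add, mul_smul_comm, smul_mul_assoc, smul_smul, mul_assoc]
    rw [add_assoc, mul_comm c (-p ^ 2 * _)]
    simp only [mul_assoc]

end Algebra

/-- A `2 × 2` matrix acting on the site `j` of `V^{⊗M}`, identity elsewhere. -/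
def siteMatrix {M : ℕ} (j : Fin M) (X : Matrix (Fin 2) (Fin 2) ℂ) :
    Matrix (Fin M → Fin 2) (Fin M → Fin 2) ℂ :=
  Matrix.of fun s t => X (s j) (t j) * (if ∀ i, i ≠ j → s i = t i then 1 else 0)

lemma siteMatrix_mul_apply {M : ℕ} (j : Fin M) (X : Matrix (Fin 2) (Fin 2) ℂ)
    (Z : Matrix (Fin M → Fin 2) (Fin M → Fin 2) ℂ) (s t : Fin M → Fin 2) :
    (siteMatrix j X * Z) s t = ∑ c, X (s j) c * Z (Function.update s j c) t := by
  have hinj : Function.Injective fun c => Function.update s j c := Function.update_injective s j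
  rw [Matrix.mul_apply]
  symm
  refine Finset.sum_of_injOn (fun c => Function.update s j c) hinj.injOn (by simp) ?_ ?_
  · intro w _ hw
    have : ¬ ∀ i, i ≠ j → s i = w i := by
      intro h
      apply hw
      refine ⟨w j, by simp, ?_⟩
      funext i
      by_cases hi : i = j
      · subst hi; simp
      · simp [hi, h i hi]
    simp [siteMatrix, this]
  · intro c _
    have : ∀ i, i ≠ j → s i = Function.update s j c i := fun i hi => by simp [hi]
    rw [siteMatrix, Matrix.of_apply, if_pos this, mul_one, Function.update_self]

lemma mul_siteMatrix_apply {M : ℕ} (j : Fin M) (X : Matrix (Fin 2) (Fin 2) ℂ)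
    (Z : Matrix (Fin M → Fin 2) (Fin M → Fin 2) ℂ) (s t : Fin M → Fin 2) :
    (Z * siteMatrix j X) s t = ∑ c, Z s (Function.update t j c) * X c (t j) := by
  have hT : (siteMatrix j X).transpose = siteMatrix j X.transpose := by
    ext a b
    simp only [siteMatrix, Matrix.transpose_apply, Matrix.of_apply, eq_comm]
  have h := siteMatrix_mul_apply j X.transpose Z.transpose t s
  rw [← hT, ← Matrix.transpose_mul, Matrix.transpose_apply] at h
  simpa [mul_comm] using h

lemma siteMatrix_one {M : ℕ} (j : Fin M) : siteMatrix j 1 = 1 := by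
  ext s t
  simp only [siteMatrix, Matrix.of_apply, Matrix.one_apply, ← ite_and, mul_ite, mul_one, mul_zero]
  refine if_congr ⟨fun h => funext fun i => ?_, fun h => by simp [h]⟩ rfl rfl
  by_cases hi : i = j
  · rw [hi, h.2]
  · exact h.1 i hi

lemma siteMatrix_mul {M : ℕ} (j : Fin M) (X Y : Matrix (Fin 2) (Fin 2) ℂ) :
    siteMatrix j (X * Y) = siteMatrix j X * siteMatrix j Y := by
  ext s t
  have hif : ∀ c, (∀ i, i ≠ j → Function.update s j c i = t i) ↔ ∀ i, i ≠ j → s i = t i :=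
    fun c => forall₂_congr fun i hi => by simp [hi]
  rw [siteMatrix_mul_apply]
  simp only [siteMatrix, Matrix.of_apply, Matrix.mul_apply, Function.update_self, hif,
    Finset.sum_mul, mul_assoc]

lemma siteMatrix_commute {M : ℕ} {i j : Fin M} (hij : i ≠ j) (X Y : Matrix (Fin 2) (Fin 2) ℂ) :
    Commute (siteMatrix i X) (siteMatrix j Y) := by
  rw [commute_iff_eq, ← mul_one (siteMatrix i X * _), ← mul_one (siteMatrix j Y * _), mul_assoc,
    mul_assoc]
  ext s t
  simp only [siteMatrix_mul_apply, Function.update_of_ne hij, Function.update_of_ne hij.symm,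
    Finset.mul_sum]
  rw [Finset.sum_comm]
  refine Finset.sum_congr rfl fun c _ => Finset.sum_congr rfl fun d _ => ?_
  rw [Function.update_comm hij]
  ring

/-- `siteMatrix` as an algebra homomorphism. -/
def siteHom {M : ℕ} (j : Fin M) :
    Matrix (Fin 2) (Fin 2) ℂ →ₐ[ℂ] Matrix (Fin M → Fin 2) (Fin M → Fin 2) ℂ :=
  AlgHom.ofLinearMap
    { toFun := siteMatrix j
      map_add' := fun X Y => by
        ext s t
        simp only [siteMatrix, Matrix.of_apply, Matrix.add_apply, add_mul]
      map_smul' := fun c X => by ext s t; simp [siteMatrix] }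
    (siteMatrix_one j) (siteMatrix_mul j)

lemma siteHom_apply {M : ℕ} (j : Fin M) (X : Matrix (Fin 2) (Fin 2) ℂ) :
    siteHom j X = siteMatrix j X := rfl

section RTT

variable {𝒜 : Type*} [Ring 𝒜]

/-- The product of the entries of two matrices acting on two different auxiliary spaces. -/
def pairMul (T T' : Matrix (Fin 2) (Fin 2) 𝒜) : Matrix (Fin 2 × Fin 2) (Fin 2 × Fin 2) 𝒜 :=
  Matrix.of fun s t => T s.1 t.1 * T' s.2 t.2

/-- `pairMul` with the entries multiplied in the opposite order. -/
def pairMulRev (T T' : Matrix (Fin 2) (Fin 2) 𝒜) : Matrix (Fin 2 × Fin 2) (Fin 2 × Fin 2) 𝒜 :=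
  Matrix.of fun s t => T' s.2 t.2 * T s.1 t.1

lemma pairMul_mul (L L' T T' : Matrix (Fin 2) (Fin 2) 𝒜)
    (h : ∀ a b c d, Commute (T a b) (L' c d)) :
    pairMul (L * T) (L' * T') = pairMul L L' * pairMul T T' := by
  ext ⟨a, b⟩ ⟨e, f⟩
  simp only [pairMul, Matrix.of_apply, Matrix.mul_apply, Fintype.sum_prod_type, Finset.sum_mul_sum]
  refine Finset.sum_congr rfl fun g _ => Finset.sum_congr rfl fun k _ => ?_
  rw [mul_assoc, ← mul_assoc (T g e), (h g e b k).eq, mul_assoc, mul_assoc]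

lemma pairMulRev_mul (L L' T T' : Matrix (Fin 2) (Fin 2) 𝒜)
    (h : ∀ a b c d, Commute (T' a b) (L c d)) :
    pairMulRev (L * T) (L' * T') = pairMulRev L L' * pairMulRev T T' := by
  ext ⟨a, b⟩ ⟨e, f⟩
  simp only [pairMulRev, Matrix.of_apply, Matrix.mul_apply, Fintype.sum_prod_type,
    Finset.sum_mul_sum]
  rw [Finset.sum_comm]
  refine Finset.sum_congr rfl fun g _ => Finset.sum_congr rfl fun k _ => ?_
  rw [mul_assoc, ← mul_assoc (T' k f), (h k f a g).eq, mul_assoc, mul_assoc]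

variable [Algebra ℂ 𝒜]

/-- The `RTT` relation. -/
def RTT (R : Matrix (Fin 2 × Fin 2) (Fin 2 × Fin 2) ℂ) (T T' : Matrix (Fin 2) (Fin 2) 𝒜) : Prop :=
  R.map (algebraMap ℂ 𝒜) * pairMul T T' = pairMulRev T T' * R.map (algebraMap ℂ 𝒜)

lemma RTT.mul {R : Matrix (Fin 2 × Fin 2) (Fin 2 × Fin 2) ℂ} {L L' T T' : Matrix (Fin 2) (Fin 2) 𝒜}
    (hL : RTT R L L') (hT : RTT R T T') (h : ∀ a b c d, Commute (T a b) (L' c d))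
    (h' : ∀ a b c d, Commute (T' a b) (L c d)) : RTT R (L * T) (L' * T') := by
  unfold RTT at *
  rw [pairMul_mul _ _ _ _ h, pairMulRev_mul _ _ _ _ h', ← mul_assoc, hL, mul_assoc, hT, mul_assoc]

lemma RTT.one (R : Matrix (Fin 2 × Fin 2) (Fin 2 × Fin 2) ℂ) :
    RTT R (1 : Matrix (Fin 2) (Fin 2) 𝒜) 1 := by
  have h1 : pairMul (1 : Matrix (Fin 2) (Fin 2) 𝒜) 1 = 1 := by
    ext ⟨a, b⟩ ⟨c, d⟩
    simp [pairMul, Matrix.one_apply, ← ite_and, Prod.ext_iff, and_comm]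
  have h2 : pairMulRev (1 : Matrix (Fin 2) (Fin 2) 𝒜) 1 = 1 := by
    ext ⟨a, b⟩ ⟨c, d⟩
    simp [pairMulRev, Matrix.one_apply, ← ite_and, Prod.ext_iff]
  rw [RTT, h1, h2, mul_one, one_mul]

lemma RTT.map {ℬ : Type*} [Ring ℬ] [Algebra ℂ ℬ] (φ : 𝒜 →ₐ[ℂ] ℬ)
    {R : Matrix (Fin 2 × Fin 2) (Fin 2 × Fin 2) ℂ} {T T' : Matrix (Fin 2) (Fin 2) 𝒜}
    (h : RTT R T T') : RTT R (T.map φ) (T'.map φ) := by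
  have h' := congrArg (fun X => X.map φ) h
  simp only [Matrix.map_mul] at h'
  have hR : (R.map (algebraMap ℂ 𝒜)).map φ = R.map (algebraMap ℂ ℬ) := by
    ext; simp
  have h1 : (pairMul T T').map φ = pairMul (T.map φ) (T'.map φ) := by
    ext; simp [pairMul]
  have h2 : (pairMulRev T T').map φ = pairMulRev (T.map φ) (T'.map φ) := by
    ext; simp [pairMulRev]
  rwa [hR, h1, h2] at h'

/-- The `R`-matrix intertwining two Felderhof `L`-operators. -/
def Rfel (p u v : ℂ) : Matrix (Fin 2 × Fin 2) (Fin 2 × Fin 2) ℂ :=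
  toPair !![p ^ 2 * u - v, 0, 0, 0;
            0, p ^ 2 * (v - u), (p ^ 2 - 1) * v, 0;
            0, (p ^ 2 - 1) * u, v - u, 0;
            0, 0, 0, p ^ 2 * v - u]

lemma RTT.exchange_BB {p u v : ℂ} {T T' : Matrix (Fin 2) (Fin 2) 𝒜} (h : RTT (Rfel p u v) T T') :
    (p ^ 2 * u - v) • (T 0 1 * T' 0 1) = (p ^ 2 * v - u) • (T' 0 1 * T 0 1) := by
  have h' := congrFun₂ h (0, 0) (1, 1)
  simp only [Algebra.smul_def]
  rw [Algebra.commutes (p ^ 2 * v - u)]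
  simpa [Matrix.mul_apply, Fintype.sum_prod_type, Rfel, toPair, pidx, pairMul, pairMulRev]
    using h'

lemma RTT.exchange_BD {p u v : ℂ} {T T' : Matrix (Fin 2) (Fin 2) 𝒜} (h : RTT (Rfel p u v) T T') :
    (p ^ 2 * (v - u)) • (T 0 1 * T' 1 1) + ((p ^ 2 - 1) * v) • (T 1 1 * T' 0 1)
      = (p ^ 2 * v - u) • (T' 1 1 * T 0 1) := by
  have h' := congrFun₂ h (0, 1) (1, 1)
  simp only [Algebra.smul_def]
  rw [Algebra.commutes (p ^ 2 * v - u)]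
  simpa [Matrix.mul_apply, Fintype.sum_prod_type, Rfel, toPair, pidx, pairMul, pairMulRev]
    using h'

end RTT

/-- The Felderhof `L`-operator as a matrix of operators on one site. -/
def laxBlock (p q u : ℂ) : Matrix (Fin 2) (Fin 2) (Matrix (Fin 2) (Fin 2) ℂ) :=
  !![!![1 - p * q * u, 0; 0, -p ^ 2 * (1 - p⁻¹ * q * u)], !![0, 0; 1 - q ^ 2, 0];
     !![0, (1 - p ^ 2) * u; 0, 0], !![u - p⁻¹ * q, 0; 0, u - p * q]]

lemma laxBlock_apply (p q u : ℂ) (a b s t : Fin 2) :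
    laxBlock p q u a b s t = Lfel u p q (a, s) (b, t) := by
  fin_cases a <;> fin_cases b <;> fin_cases s <;> fin_cases t <;> rfl

set_option maxHeartbeats 4000000 in
lemma laxBlock_RTT (p q u v : ℂ) (hp : p ≠ 0) :
    RTT (Rfel p u v) (laxBlock p q u) (laxBlock p q v) := by
  ext ⟨a, b⟩ ⟨c, d⟩ s t
  fin_cases a <;> fin_cases b <;> fin_cases c <;> fin_cases d <;> fin_cases s <;> fin_cases t <;>
    simp [Matrix.mul_apply, Fintype.sum_prod_type, Rfel, toPair, pidx, pairMul, pairMulRev,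
      laxBlock, Matrix.algebraMap_matrix_apply, Matrix.sum_apply] <;> field_simp <;> ring

/-- The product `L_{am} ⋯ L_{a1}` as a matrix of operators on `V^{⊗M}`. -/
def partialMonodromy (p q : ℂ) {M : ℕ} : (m : ℕ) → m ≤ M → ℂ →
    Matrix (Fin 2) (Fin 2) (Matrix (Fin M → Fin 2) (Fin M → Fin 2) ℂ)
  | 0, _, _ => 1
  | m + 1, h, u => (laxBlock p q u).map (siteHom ⟨m, h⟩) *
      partialMonodromy p q m (Nat.le_of_succ_le h) u

lemma siteHom_commute_partialMonodromy (p q : ℂ) {M m : ℕ} (hm : m ≤ M) (u : ℂ) (j : Fin M)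
    (hj : m ≤ j) (X : Matrix (Fin 2) (Fin 2) ℂ) (a b : Fin 2) :
    Commute (siteHom j X) (partialMonodromy p q m hm u a b) := by
  induction m generalizing a b with
  | zero =>
    rw [partialMonodromy, Matrix.one_apply]
    split_ifs
    · exact Commute.one_right _
    · exact Commute.zero_right _
  | succ m ih =>
    rw [partialMonodromy, Matrix.mul_apply]
    refine Commute.sum_right _ _ _ fun c _ => Commute.mul_right ?_ ?_
    · refine siteMatrix_commute ?_ _ _
      rintro rfl
      simp at hj
    · exact ih _ (Nat.le_of_succ_le hj) _ _

lemma partialMonodromy_RTT (p q : ℂ) (hp : p ≠ 0) {M m : ℕ} (hm : m ≤ M) (u v : ℂ) :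
    RTT (Rfel p u v) (partialMonodromy p q m hm u) (partialMonodromy p q m hm v) := by
  induction m with
  | zero => exact RTT.one _
  | succ m ih =>
    exact ((laxBlock_RTT p q u v hp).map (siteHom ⟨m, hm⟩)).mul (ih _)
      (fun _ _ _ _ => (siteHom_commute_partialMonodromy p q _ u ⟨m, hm⟩ le_rfl _ _ _).symm)
      (fun _ _ _ _ => (siteHom_commute_partialMonodromy p q _ v ⟨m, hm⟩ le_rfl _ _ _).symm)

lemma Bop_eq_partialMonodromy (p q : ℂ) (M : ℕ) (u : ℂ) :
    Bop M (fun _ => Lfel u p q) = partialMonodromy p q M le_rfl u 0 1 := by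
  have key : ∀ (m : ℕ) (hm : m ≤ M),
      (List.ofFn fun j : Fin m => siteOp M (fun _ => Lfel u p q) (Fin.castLE hm j)).reverse.prod
        = Matrix.compRingEquiv _ _ _ (partialMonodromy p q m hm u) := by
    intro m
    induction m with
    | zero => intro hm; rw [partialMonodromy, map_one]; simp
    | succ m ih =>
      intro hm
      rw [List.ofFn_succ_last, List.reverse_append, List.prod_append, partialMonodromy, map_mul,
        ← ih (Nat.le_of_succ_le hm)]
      simp only [List.reverse_singleton, List.prod_singleton]
      congr 1
      ext ⟨a, s⟩ ⟨b, t⟩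
      simp only [siteOp, Matrix.of_apply, Matrix.compRingEquiv_apply, Matrix.comp_apply,
        Matrix.map_apply, siteHom_apply, siteMatrix, laxBlock_apply]
      rfl
  ext s t
  have h := key M le_rfl
  simp only [Fin.castLE_rfl, id] at h
  rw [Bop, Matrix.of_apply, monodromy, h]
  rfl

lemma partialMonodromy_succ_row_zero (p q : ℂ) {M m : ℕ} (hm : m + 1 ≤ M) (u : ℂ) (b : Fin 2) :
    partialMonodromy p q (m + 1) hm u 0 b
      = siteHom ⟨m, hm⟩ (laxBlock p q u 0 0) * partialMonodromy p q m (Nat.le_of_succ_le hm) u 0 b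
        + siteHom ⟨m, hm⟩ (laxBlock p q u 0 1)
          * partialMonodromy p q m (Nat.le_of_succ_le hm) u 1 b := by
  rw [partialMonodromy, Matrix.mul_apply, Fin.sum_univ_two]
  rfl

lemma partialMonodromy_D_row (p q : ℂ) {M m : ℕ} (hm : m ≤ M) (u : ℂ) (t : Fin M → Fin 2) :
    partialMonodromy p q m hm u 1 1 (fun _ => 1) t
      = (u - p * q) ^ m * (1 : Matrix (Fin M → Fin 2) (Fin M → Fin 2) ℂ) (fun _ => 1) t := by
  induction m with
  | zero => simp [partialMonodromy]
  | succ m ih =>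
    have hup : Function.update (fun _ : Fin M => (1 : Fin 2)) ⟨m, hm⟩ 1 = fun _ => 1 :=
      Function.update_eq_self _ _
    rw [partialMonodromy, Matrix.mul_apply, Fin.sum_univ_two, Matrix.add_apply]
    simp only [Matrix.map_apply, siteHom_apply, siteMatrix_mul_apply, Fin.sum_univ_two, hup, ih]
    simp [laxBlock]
    ring

lemma D_mul_row (p q : ℂ) {M m : ℕ} (hm : m ≤ M) (u : ℂ)
    (X : Matrix (Fin M → Fin 2) (Fin M → Fin 2) ℂ) (t : Fin M → Fin 2) :
    (partialMonodromy p q m hm u 1 1 * X) (fun _ => 1) t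
      = (u - p * q) ^ m * X (fun _ => 1) t := by
  rw [Matrix.mul_apply]
  simp only [partialMonodromy_D_row, mul_assoc, ← Finset.mul_sum, ← Matrix.mul_apply, one_mul]

/-- Splitting the last site off the row of the fully occupied state. -/
lemma partialMonodromy_prod_row_succ (p q : ℂ) (hp : p ≠ 0) {M m : ℕ} (hm : m + 1 ≤ M) {n : ℕ}
    (u : Fin (n + 1) → ℂ) (hu : Function.Injective u) (hden : ∀ j, 1 - p⁻¹ * q * u j ≠ 0)
    (t : Fin M → Fin 2) :
    (List.ofFn fun i => partialMonodromy p q (m + 1) hm (u i) 0 1).prod (fun _ => 1) t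
      = if t ⟨m, hm⟩ = 1 then
          (∏ i, (-p ^ 2 * (1 - p⁻¹ * q * u i))) *
            (List.ofFn fun i => partialMonodromy p q m (Nat.le_of_succ_le hm) (u i) 0 1).prod
              (fun _ => 1) t
        else (1 - q ^ 2) * ∑ k, exchangeCoeff p q u k * ((u k - p * q) ^ m *
            (List.ofFn fun i => partialMonodromy p q m (Nat.le_of_succ_le hm)
              (u (k.succAbove i)) 0 1).prod (fun _ => 1) (Function.update t ⟨m, hm⟩ 1)) := by
  have hm' := Nat.le_of_succ_le hm
  set j : Fin M := ⟨m, hm⟩ with hj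
  have hcomm := fun u X a b => (siteHom_commute_partialMonodromy p q hm' u j le_rfl X a b).eq
  have e₁₁ : ∀ u, !![0, 0; 0, 1] * laxBlock p q u 0 0
      = (-p ^ 2 * (1 - p⁻¹ * q * u)) • !![0, 0; 0, 1] := fun u => by
    ext a b; fin_cases a <;> fin_cases b <;> simp [laxBlock]
  have e₁₂ : ∀ u, !![0, 0; 0, 1] * laxBlock p q u 0 1 = (1 - q ^ 2) • !![0, 0; 1, 0] := fun u => by
    ext a b; fin_cases a <;> fin_cases b <;> simp [laxBlock]
  have e₂₁ : ∀ u, !![0, 0; 1, 0] * laxBlock p q u 0 0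
      = (1 - p * q * u) • !![0, 0; 1, 0] := fun u => by
    ext a b; fin_cases a <;> fin_cases b <;> simp [laxBlock]
  have e₂₂ : ∀ u, !![0, 0; 1, 0] * laxBlock p q u 0 1 = 0 := fun u => by
    ext a b; fin_cases a <;> fin_cases b <;> simp [laxBlock]
  have h := mul_prod_split p q (1 - q ^ 2) hp
    (fun u => partialMonodromy p q m hm' u 0 1) (fun u => partialMonodromy p q m hm' u 1 1)
    (fun u => partialMonodromy p q (m + 1) hm u 0 1)
    (siteHom j !![0, 0; 0, 1]) (siteHom j !![0, 0; 1, 0])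
    (fun u v => (partialMonodromy_RTT p q hp hm' u v).exchange_BB)
    (fun u v => (partialMonodromy_RTT p q hp hm' u v).exchange_BD)
    (fun u => by
      rw [partialMonodromy_succ_row_zero, mul_add, ← mul_assoc, ← mul_assoc, ← map_mul, ← map_mul,
        e₁₁, e₁₂, map_smul, map_smul, smul_mul_assoc, smul_mul_assoc, hcomm, hcomm])
    (fun u => by
      rw [partialMonodromy_succ_row_zero, mul_add, ← mul_assoc, ← mul_assoc, ← map_mul, ← map_mul,
        e₂₁, e₂₂, map_smul, map_zero, zero_mul, add_zero, smul_mul_assoc, hcomm])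
    n u hu hden
  have hup : Function.update (fun _ : Fin M => (1 : Fin 2)) j 1 = fun _ => 1 :=
    Function.update_eq_self _ _
  have h' := congrFun₂ h (fun _ => 1) t
  simp only [siteHom_apply, siteMatrix_mul_apply, mul_siteMatrix_apply, Matrix.add_apply,
    Matrix.smul_apply, Fin.sum_univ_two, hup, Matrix.sum_apply, D_mul_row, smul_eq_mul] at h'
  have ht : t j = 0 ∨ t j = 1 := by omega
  rcases ht with ht | ht
  · simpa [ht] using h'
  · have hut : Function.update t j 1 = t := by rw [← ht]; exact Function.update_eq_self _ _
    simpa [ht, hut] using h'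

lemma prod_ite_lt_succAbove (n : ℕ) (k : Fin (n + 1)) :
    (∏ i, if k.succAbove i < k then (1 : ℂ) else -1) = (-1) ^ ((k : ℕ) + n) := by
  induction n with
  | zero =>
    obtain rfl : k = 0 := Fin.fin_one_eq_zero k
    simp
  | succ n ih =>
    induction k using Fin.cases with
    | zero => simp
    | succ k =>
      rw [Fin.prod_univ_succ]
      simp only [Fin.succ_succAbove_succ, Fin.succ_succAbove_zero, Fin.succ_lt_succ_iff,
        Fin.succ_pos, if_true, ih, one_mul, Fin.val_succ]
      ring

/-- The factorised prefactor of the wavefunction. -/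
def pairFactor (p : ℂ) {n : ℕ} (u : Fin n → ℂ) : ℂ :=
  ∏ j, ∏ k, if j < k then (p ^ 2 * u k - u j) / (p ^ 2 * (u k - u j)) else 1

lemma exchangeCoeff_mul_pairFactor (p q : ℂ) {n : ℕ} (u : Fin (n + 1) → ℂ) (k : Fin (n + 1)) :
    exchangeCoeff p q u k * pairFactor p (fun i => u (k.succAbove i))
      = (-1) ^ ((k : ℕ) + n) * (∏ i, (-p ^ 2 * (1 - p⁻¹ * q * u (k.succAbove i))))
        * pairFactor p u := by
  have hpair : pairFactor p u = (∏ i,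
      (if k < k.succAbove i then
        (p ^ 2 * u (k.succAbove i) - u k) / (p ^ 2 * (u (k.succAbove i) - u k)) else 1)
      * (if k.succAbove i < k then
        (p ^ 2 * u k - u (k.succAbove i)) / (p ^ 2 * (u k - u (k.succAbove i))) else 1))
      * pairFactor p (fun i => u (k.succAbove i)) := by
    unfold pairFactor
    rw [Fin.prod_univ_succAbove _ k, Fin.prod_univ_succAbove _ k]
    simp only [Fin.prod_univ_succAbove (n := n) _ k, lt_self_iff_false, if_false, one_mul,
      Finset.prod_mul_distrib, Fin.succAbove_lt_succAbove_iff]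
    ring
  rw [hpair, ← prod_ite_lt_succAbove, ← mul_assoc, ← Finset.prod_mul_distrib,
    ← Finset.prod_mul_distrib, exchangeCoeff]
  congr 1
  refine Finset.prod_congr rfl fun i _ => ?_
  rcases lt_or_gt_of_ne (Fin.succAbove_ne k i) with h | h
  · simp [h, h.not_gt]
  · simp only [h, h.not_gt, if_true, if_false]
    rw [← neg_sub (u k) (u (k.succAbove i)), mul_neg, div_neg]
    ring

lemma holeConf_eq_one {M N : ℕ} {x : Fin N → Fin M} {i : Fin M} (h : ∀ j, x j ≠ i) :
    holeConf x i = 1 := by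
  simp [holeConf, h]

lemma holeConf_fin_zero {M : ℕ} (x : Fin 0 → Fin M) : holeConf x = fun _ => 1 :=
  funext fun _ => holeConf_eq_one fun j => j.elim0

lemma update_holeConf_last {M n : ℕ} {x : Fin (n + 1) → Fin M} (hx : StrictMono x) :
    Function.update (holeConf x) (x (Fin.last n)) 1 = holeConf fun i => x i.castSucc := by
  funext i
  by_cases hi : i = x (Fin.last n)
  · subst hi
    rw [Function.update_self, holeConf_eq_one]
    exact fun j => (hx (Fin.castSucc_lt_last j)).ne
  · rw [Function.update_of_ne hi]
    simp only [holeConf, Fin.exists_fin_succ', or_iff_left (Ne.symm hi)]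

/-- The hole wavefunction on the first `m` sites. -/
lemma partialMonodromy_hole_wavefunction (p q : ℂ) (hp : p ≠ 0) {M m : ℕ} (hm : m ≤ M) (N : ℕ)
    (u : Fin N → ℂ) (hu : Function.Injective u) (hden : ∀ j, 1 - p⁻¹ * q * u j ≠ 0)
    (x : Fin N → Fin M) (hx : StrictMono x) (hxm : ∀ j, (x j : ℕ) < m) :
    (List.ofFn fun j => partialMonodromy p q m hm (u j) 0 1).prod (fun _ => 1) (holeConf x)
      = (∏ j, (1 - q ^ 2) * ((-p ^ 2 * (1 - p⁻¹ * q * u j)) ^ m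
          / (-p ^ 2 * (1 - p⁻¹ * q * u j))))
        * pairFactor p u
        * Matrix.det (Matrix.of fun j k : Fin N =>
            ((u j - p * q) / (-p ^ 2 * (1 - p⁻¹ * q * u j))) ^ (x k : ℕ)) := by
  induction m generalizing N with
  | zero =>
    cases N with
    | zero => simp [holeConf_fin_zero, pairFactor]
    | succ n => exact absurd (hxm 0) (Nat.not_lt_zero _)
  | succ m ih =>
    cases N with
    | zero => simp [holeConf_fin_zero, pairFactor]
    | succ n =>
      rw [partialMonodromy_prod_row_succ p q hp hm u hu hden]
      by_cases hlast : (x (Fin.last n) : ℕ) = m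
      · have hxl : x (Fin.last n) = ⟨m, hm⟩ := Fin.ext hlast
        have h0 : holeConf x ⟨m, hm⟩ = 0 := by
          rw [← hxl]
          simp [holeConf]
        rw [h0, if_neg (by decide), ← hxl, update_holeConf_last hx,
          Matrix.det_succ_column _ (Fin.last n), Finset.mul_sum, Finset.mul_sum]
        refine Finset.sum_congr rfl fun k _ => ?_
        rw [ih _ n (fun i => u (k.succAbove i)) (hu.comp Fin.succAbove_right_injective)
          (fun j => hden _) (fun i => x i.castSucc)
          (fun i j hij => hx (Fin.castSucc_lt_castSucc_iff.2 hij))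
          (fun j => hlast ▸ hx (Fin.castSucc_lt_last j))]
        have hC := exchangeCoeff_mul_pairFactor p q u k
        have hdet : ((Matrix.of fun j k : Fin (n + 1) =>
            ((u j - p * q) / (-p ^ 2 * (1 - p⁻¹ * q * u j))) ^ (x k : ℕ)).submatrix k.succAbove
              (Fin.last n).succAbove)
            = Matrix.of fun j l : Fin n => ((u (k.succAbove j) - p * q)
              / (-p ^ 2 * (1 - p⁻¹ * q * u (k.succAbove j)))) ^ (x l.castSucc : ℕ) := by
          ext i j
          simp
        rw [hdet, Matrix.of_apply, hlast, Fin.val_last, div_pow,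
          Fin.prod_univ_succAbove _ k]
        generalize Matrix.det (_ : Matrix (Fin n) (Fin n) ℂ) = Δ
        have hprod : ∏ i, (1 - q ^ 2) * ((-p ^ 2 * (1 - p⁻¹ * q * u (k.succAbove i))) ^ (m + 1)
              / (-p ^ 2 * (1 - p⁻¹ * q * u (k.succAbove i))))
            = (∏ i, (-p ^ 2 * (1 - p⁻¹ * q * u (k.succAbove i)))) *
              ∏ i, (1 - q ^ 2) * ((-p ^ 2 * (1 - p⁻¹ * q * u (k.succAbove i))) ^ m
              / (-p ^ 2 * (1 - p⁻¹ * q * u (k.succAbove i)))) := by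
          rw [← Finset.prod_mul_distrib]
          exact Finset.prod_congr rfl fun i _ => by ring
        rw [hprod]
        have hk : -p ^ 2 * (1 - p⁻¹ * q * u k) ≠ 0 :=
          mul_ne_zero (neg_ne_zero.2 (pow_ne_zero _ hp)) (hden k)
        have hk' : (-p ^ 2 * (1 - p⁻¹ * q * u k)) ^ (m + 1) / (-p ^ 2 * (1 - p⁻¹ * q * u k))
            * ((u k - p * q) ^ m / (-p ^ 2 * (1 - p⁻¹ * q * u k)) ^ m) = (u k - p * q) ^ m := by
          rw [pow_succ, mul_div_cancel_right₀ _ hk, mul_div_cancel₀ _ (pow_ne_zero _ hk)]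
        generalize (∏ i, (1 - q ^ 2) * ((-p ^ 2 * (1 - p⁻¹ * q * u (k.succAbove i))) ^ m
              / (-p ^ 2 * (1 - p⁻¹ * q * u (k.succAbove i))))) = P at *
        linear_combination (1 - q ^ 2) * (u k - p * q) ^ m * P * Δ * hC
          - (1 - q ^ 2) * P * Δ * (-1) ^ ((k : ℕ) + n)
            * (∏ i, (-p ^ 2 * (1 - p⁻¹ * q * u (k.succAbove i)))) * pairFactor p u * hk'
      · have hlt : ∀ j, (x j : ℕ) < m := fun j =>
          lt_of_le_of_lt (hx.monotone (Fin.le_last j))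
            (lt_of_le_of_ne (Nat.lt_succ_iff.1 (hxm _)) hlast)
        rw [holeConf_eq_one fun j h => (hlt j).ne (congrArg Fin.val h), if_pos rfl,
          ih _ (n + 1) u hu hden x hx hlt, ← mul_assoc, ← mul_assoc, ← Finset.prod_mul_distrib]
        congr 2
        exact Finset.prod_congr rfl fun i _ => by ring

/-- The hole wavefunction `⟨1⋯M|B(u₁)⋯B(u_N)|x̄₁⋯x̄_N⟩` of the Felderhof
model. Hole positions are `1`-indexed: `x̄_j` is `(x j : ℕ) + 1`, so `x̄_k − 1 = (x k : ℕ)`. -/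
theorem felderhof_hole_wavefunction (p q : ℂ) (hp : p ≠ 0)
    (M N : ℕ) (hN : 1 ≤ N) (hMN : N ≤ M)
    (u : Fin N → ℂ) (hdist : ∀ j k, j ≠ k → u j ≠ u k)
    (hden : ∀ j, 1 - p⁻¹ * q * u j ≠ 0)
    (x : Fin N → Fin M) (hx : StrictMono x) :
    ((List.ofFn fun j : Fin N => Bop M (fun _ => Lfel (u j) p q)).prod)
        (fun _ => 1) (holeConf x)
      = (∏ j, (1 - q ^ 2) * (-p ^ 2 * (1 - p⁻¹ * q * u j)) ^ (M - 1))
        * (∏ j, ∏ k, if j < k then (p ^ 2 * u k - u j) / (p ^ 2 * (u k - u j)) else 1)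
        * Matrix.det (Matrix.of fun j k : Fin N =>
            ((u j - p * q) / (-p ^ 2 * (1 - p⁻¹ * q * u j))) ^ (x k : ℕ)) := by
  have hu : Function.Injective u := fun j k h => by
    by_contra hjk
    exact hdist j k hjk h
  have h := partialMonodromy_hole_wavefunction p q hp le_rfl N u hu hden x hx fun j => (x j).isLt
  simp only [Bop_eq_partialMonodromy]
  rw [h, pairFactor]
  congr 2
  refine Finset.prod_congr rfl fun j _ => ?_
  have ha : -p ^ 2 * (1 - p⁻¹ * q * u j) ≠ 0 :=
    mul_ne_zero (neg_ne_zero.2 (pow_ne_zero _ hp)) (hden j)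
  obtain ⟨K, rfl⟩ : ∃ K, M = K + 1 := ⟨M - 1, by omega⟩
  rw [pow_succ _ K, mul_div_cancel_right₀ _ ha, Nat.add_sub_cancel]
end
end

section
/- Let p, q ∈ ℂ and let u₁, u₂, … be pairwise distinct complex numbers with 1−pqu_j ≠ 0 and pu_j−q ≠ 0 for all j. Define matrices D_n, C_n on (ℂ²)^{⊗n} recursively by D₁ = diag(1−pqu₁, u₁−p⁻¹q), C₁ = [[0,1−q²],[0,0]], and D_{n+1} = diag(1−pqu_{n+1}, u_{n+1}−p⁻¹q) ⊗ D_n + [[0,0],[(1−p²)u_{n+1},0]] ⊗ C_n, C_{n+1} = [[0,1−q²],[0,0]] ⊗ D_n + diag(−p²(1−p⁻¹qu_{n+1}), u_{n+1}−pq) ⊗ C_n. Then for every n there exist matrices C_n^{(1)},…,C_n^{(n)} on (ℂ²)^{⊗n} with C_n = Σ_{j=1}^n C_n^{(j)} such that: C_n^{(j)} D_n = ((u_j−p⁻¹q)/(1−pqu_j)) D_n C_n^{(j)} for all j; (C_n^{(j)})² = 0 for all j; and C_n^{(j)} C_n^{(k)} = −[(pu_j−q)(1−pqu_k)]/[(pu_k−q)(1−pqu_j)]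 · C_n^{(k)} C_n^{(j)} for all j ≠ k. -/
noncomputable section

/-- Kronecker product of a `2 × 2` matrix with a matrix on `(ℂ²)^{⊗n}`, giving a matrix
on `(ℂ²)^{⊗(n+1)}` (the `2 × 2` factor acting on the new leftmost tensor factor). -/
def kron2 {n : ℕ} (A : Matrix (Fin 2) (Fin 2) ℂ)
    (B : Matrix (Fin n → Fin 2) (Fin n → Fin 2) ℂ) :
    Matrix (Fin (n + 1) → Fin 2) (Fin (n + 1) → Fin 2) ℂ :=
  Matrix.of fun s t => A (s 0) (t 0) * B (fun i => s i.succ) (fun i => t i.succ)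

/-- `C` is a sum of `n` elements that are `lam`-commuting with the invertible element `D` and
that pairwise satisfy twisted anticommutation relations. -/
def HasExchangeDecomposition {R : Type*} [Ring R] [Algebra ℂ R] (lam : ℕ → ℂ) (n : ℕ)
    (D C : R) : Prop :=
  IsUnit D ∧ ∃ X : Fin n → R, C = ∑ j, X j ∧
    (∀ j, X j * D = lam j • (D * X j)) ∧
    ∀ j k : Fin n, lam k • (X j * X k) = -(lam j • (X k * X j))

theorem HasExchangeDecomposition.map {R S : Type*} [Ring R] [Algebra ℂ R] [Ring S] [Algebra ℂ S]
    {lam : ℕ → ℂ} {n : ℕ} {D C : R} (h : HasExchangeDecomposition lam n D C) (φ : R →ₐ[ℂ] S) :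
    HasExchangeDecomposition lam n (φ D) (φ C) := by
  obtain ⟨hD, X, hC, hXD, hXX⟩ := h
  refine ⟨hD.map φ, fun j => φ (X j), by rw [hC, map_sum], fun j => ?_, fun j k => ?_⟩
  · rw [← map_mul, hXD, map_smul, map_mul]
  · simpa only [map_smul, map_mul, map_neg] using congrArg φ (hXX j k)

theorem HasExchangeDecomposition.of_conj {R : Type*} [Ring R] [Algebra ℂ R]
    {lam : ℕ → ℂ} {n : ℕ} {D C D' C' : R} (h : HasExchangeDecomposition lam n D C) (G : Rˣ)
    (hD : D' * G = G * D) (hC : C' * G = G * C) :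
    HasExchangeDecomposition lam n D' C' := by
  have := h.map
    (MulSemiringAction.toAlgEquiv ℂ R (ConjAct.toConjAct G)).toAlgHom
  have key : ∀ Y Y' : R, Y' * G = G * Y →
      (MulSemiringAction.toAlgEquiv ℂ R (ConjAct.toConjAct G)).toAlgHom Y = Y' := by
    intro Y Y' hY
    simp [ConjAct.units_smul_def, ← hY]
  rwa [key D D' hD, key C C' hC] at this

/-- The unipotent lower triangular `2 × 2` block matrix. -/
def lowerUnit {R : Type*} [Ring R] (g : R) : (Matrix (Fin 2) (Fin 2) R)ˣ where
  val := !![1, 0; g, 1]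
  inv := !![1, 0; -g, 1]
  val_inv := by simp [Matrix.one_fin_two]
  inv_val := by simp [Matrix.one_fin_two]

/-- The block triangular situation in which the decomposition is visible. -/
theorem hasExchangeDecomposition_triangular {R : Type*} [Ring R] [Algebra ℂ R] {lam : ℕ → ℂ}
    {n : ℕ} (D : Rˣ) (X : Fin n → R) (hXD : ∀ j, X j * D = lam j • (D * X j))
    (hXX : ∀ j k : Fin n, lam k • (X j * X k) = -(lam j • (X k * X j)))
    {a b s : ℂ} (ha : a ≠ 0) (hb : b ≠ 0) (hlam : lam n = b / a) (α β : Fin n → ℂ)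
    (hαβ : ∀ j, α j * b + a * β j = 0) :
    HasExchangeDecomposition lam (n + 1)
      (!![a • (D : R), 0; 0, b • (D : R)] : Matrix (Fin 2) (Fin 2) R)
      !![∑ j, α j • X j, s • (D : R); 0, ∑ j, β j • X j] := by
  have hβ : ∀ j, β j = -(α j * lam n) := by
    intro j
    rw [hlam]
    field_simp
    linear_combination hαβ j
  have hab : lam n * a = b := by rw [hlam]; field_simp
  refine ⟨?_, Fin.snoc (fun j => !![α j • X j, 0; 0, β j • X j]) !![0, s • (D : R); 0, 0],
    ?_, ?_, ?_⟩
  · refine isUnit_iff_exists.mpr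
      ⟨!![a⁻¹ • ((D⁻¹ : Rˣ) : R), 0; 0, b⁻¹ • ((D⁻¹ : Rˣ) : R)], ?_, ?_⟩
    · simp [Matrix.one_fin_two, smul_smul, ha, hb]
    · simp [Matrix.one_fin_two, smul_smul, ha, hb]
  · rw [Fin.sum_univ_castSucc]
    ext i j
    fin_cases i <;> fin_cases j <;> simp [Matrix.sum_apply]
  · intro j
    refine Fin.lastCases ?_ (fun j => ?_) j
    · ext i k
      fin_cases i <;> fin_cases k <;> simp [smul_smul, ← hab]
      ring_nf
    · simp [Matrix.smul_of, hXD, smul_smul, mul_comm, mul_left_comm]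
  · intro j k
    refine Fin.lastCases ?_ (fun j => ?_) j <;> refine Fin.lastCases ?_ (fun k => ?_) k
    · simp
    · ext i l
      fin_cases i <;> fin_cases l <;> simp [hXD, smul_smul, hβ]
      ring_nf
    · ext i l
      fin_cases i <;> fin_cases l <;> simp [hXD, smul_smul, hβ]
      ring_nf
    · have h2 : ∀ x y : ℂ, (lam k * (x * y)) • (X j * X k) =
          -((lam j * (y * x)) • (X k * X j)) := by
        intro x y
        rw [mul_comm (lam k), mul_smul, hXX, smul_neg, smul_smul]
        ring_nf
      simp [smul_smul, h2]

theorem HasExchangeDecomposition.step {R : Type*} [Ring R] [Algebra ℂ R] {lam : ℕ → ℂ}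
    {n : ℕ} {D C : R} (h : HasExchangeDecomposition lam n D C)
    {a b c e f s : ℂ} (ha : a ≠ 0) (hb : b ≠ 0) (hlam : lam n = b / a)
    (hlam0 : ∀ j < n, lam j ≠ 0) (hne : ∀ j < n, lam j ≠ lam n)
    (hfree : c * b + f * a = s * e) :
    HasExchangeDecomposition lam (n + 1)
      (!![a • D, 0; e • C, b • D] : Matrix (Fin 2) (Fin 2) R)
      !![c • C, s • D; 0, f • C] := by
  obtain ⟨⟨D, rfl⟩, X, rfl, hXD, hXX⟩ := h
  have hne' : ∀ j : Fin n, a * lam j - b ≠ 0 := by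
    intro j h0
    apply hne j j.2
    rw [hlam]
    field_simp
    linear_combination h0
  have hl : ∀ j : Fin n, lam j ≠ 0 := fun j => hlam0 j j.2
  set γ : Fin n → ℂ := fun j => e / (a * lam j - b) with hγ
  have hγe : ∀ j, γ j * (a * lam j - b) = e := fun j => div_mul_cancel₀ _ (hne' j)
  have hXDi : ∀ j, X j * ((D⁻¹ : Rˣ) : R) = (lam j)⁻¹ • ((D⁻¹ : Rˣ) * X j) := by
    intro j
    have h1 : ((D⁻¹ : Rˣ) : R) * (X j * D) * (D⁻¹ : Rˣ) =
        (D⁻¹ : Rˣ) * (lam j • (D * X j)) * (D⁻¹ : Rˣ) := by rw [hXD]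
    rw [← mul_assoc, mul_assoc _ (D : R), Units.mul_inv, mul_one, mul_smul_comm, ← mul_assoc,
      Units.inv_mul, one_mul, smul_mul_assoc] at h1
    rw [h1, smul_smul, inv_mul_cancel₀ (hl j), one_smul]
  set g : R := ∑ j, γ j • ((D⁻¹ : Rˣ) * X j) with hg
  have hDg : (D : R) * g = ∑ j, γ j • X j := by
    simp [hg, Finset.mul_sum]
  have hgD : g * (D : R) = ∑ j : Fin n, (γ j * lam j) • X j := by
    simp [hg, Finset.sum_mul, mul_assoc, hXD, smul_smul]
  have hquad : f • ((∑ j, X j) * g) - c • (g * ∑ j, X j) - s • (g * (D * g)) = 0 := by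
    have hsum : f • ((∑ j, X j) * g) - c • (g * ∑ j, X j) - s • (g * (D * g)) =
        (D⁻¹ : Rˣ) * ∑ j : Fin n, ∑ k : Fin n, (f * γ k / lam j - c * γ j - s * γ j * γ k) • (X j * X k) := by
      rw [hDg, hg]
      simp only [Finset.sum_mul_sum]
      simp only [Finset.mul_sum, Finset.smul_sum, ← Finset.sum_sub_distrib]
      refine Finset.sum_congr rfl fun j _ => Finset.sum_congr rfl fun k _ => ?_
      simp only [mul_smul_comm, smul_mul_assoc, ← mul_assoc, hXDi, smul_smul, ← sub_smul]
      congr 1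
      ring
    have hanti : ∀ j k : Fin n, (f * γ k / lam j - c * γ j - s * γ j * γ k) • (X j * X k) =
        -((f * γ j / lam k - c * γ k - s * γ k * γ j) • (X k * X j)) := by
      intro j k
      have h1 : X j * X k = -((lam j / lam k) • (X k * X j)) := by
        rw [← inv_smul_smul₀ (hl k) (X j * X k), hXX, smul_neg, smul_smul]
        ring_nf
      rw [h1, smul_neg, smul_smul]
      congr 2
      have hj := hne' j
      have hk := hne' k
      have hlj := hl j
      have hlk := hl k
      simp only [hγ]
      field_simp
      linear_combination (lam j - lam k) * e * hfree
    rw [hsum]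
    convert mul_zero _
    have hself : ∀ x : R, x = -x → x = 0 := by
      intro x hx
      have h2 : (2 : ℂ) • x = 0 := by rw [two_smul]; nth_rewrite 1 [hx]; simp
      simpa using h2
    apply hself
    conv_lhs => rw [Finset.sum_comm]
    simp only [← Finset.sum_neg_distrib]
    exact Finset.sum_congr rfl fun j _ => Finset.sum_congr rfl fun k _ => hanti k j
  refine (hasExchangeDecomposition_triangular D X hXD hXX ha hb hlam (s := s)
    (fun j => c + s * γ j) (fun j => f - s * (γ j * lam j)) ?_).of_conj (lowerUnit g) ?_ ?_
  · intro j
    linear_combination hfree - s * hγe j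
  · have : e • ∑ j, X j + b • ((D : R) * g) = a • (g * (D : R)) := by
      rw [hDg, hgD]
      simp only [Finset.smul_sum, ← Finset.sum_add_distrib, smul_smul, ← add_smul]
      refine Finset.sum_congr rfl fun j _ => ?_
      congr 1
      linear_combination -hγe j
    simp [lowerUnit, this]
  · have hα : ∑ j, (c + s * γ j) • X j = c • ∑ j, X j + s • (D * g) := by
      rw [hDg]
      simp only [Finset.smul_sum, ← Finset.sum_add_distrib, smul_smul, ← add_smul]
    have hβ : ∑ j : Fin n, (f - s * (γ j * lam j)) • X j = f • ∑ j, X j - s • (g * D) := by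
      rw [hgD]
      simp only [Finset.smul_sum, ← Finset.sum_sub_distrib, smul_smul, ← sub_smul]
    rw [hα, hβ]
    have hq : f • ((∑ j, X j) * g) = c • (g * ∑ j, X j) + s • (g * (D * g)) := by
      rw [← sub_eq_zero, ← hquad]
      abel
    simp [lowerUnit, mul_add, hq]

/-- Block matrices over matrices on `(ℂ²)^{⊗n}`, seen as matrices on `(ℂ²)^{⊗(n+1)}`. -/
def blockEquiv (n : ℕ) :
    Matrix (Fin 2) (Fin 2) (Matrix (Fin n → Fin 2) (Fin n → Fin 2) ℂ) ≃ₐ[ℂ]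
      Matrix (Fin (n + 1) → Fin 2) (Fin (n + 1) → Fin 2) ℂ :=
  (Matrix.compAlgEquiv (Fin 2) (Fin n → Fin 2) ℂ ℂ).trans
    (Matrix.reindexAlgEquiv ℂ ℂ (Fin.consEquiv fun _ => Fin 2))

theorem blockEquiv_apply (n : ℕ)
    (M : Matrix (Fin 2) (Fin 2) (Matrix (Fin n → Fin 2) (Fin n → Fin 2) ℂ))
    (s t : Fin (n + 1) → Fin 2) :
    blockEquiv n M s t = M (s 0) (t 0) (fun i => s i.succ) (fun i => t i.succ) :=
  rfl

theorem HasExchangeDecomposition.kron2_step {lam : ℕ → ℂ} {n : ℕ}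
    {D C : Matrix (Fin n → Fin 2) (Fin n → Fin 2) ℂ} (h : HasExchangeDecomposition lam n D C)
    {a b c e f s : ℂ} (ha : a ≠ 0) (hb : b ≠ 0) (hlam : lam n = b / a)
    (hlam0 : ∀ j < n, lam j ≠ 0) (hne : ∀ j < n, lam j ≠ lam n)
    (hfree : c * b + f * a = s * e) :
    HasExchangeDecomposition lam (n + 1)
      (kron2 !![a, 0; 0, b] D + kron2 !![0, 0; e, 0] C)
      (kron2 !![0, s; 0, 0] D + kron2 !![c, 0; 0, f] C) := by
  have := (h.step ha hb hlam hlam0 hne hfree).map (blockEquiv n).toAlgHom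
  convert this using 1 <;>
  · ext σ τ
    rw [AlgEquiv.coe_toAlgHom, blockEquiv_apply]
    simp only [kron2, Matrix.add_apply, Matrix.of_apply]
    generalize σ 0 = i
    generalize τ 0 = j
    fin_cases i <;> fin_cases j <;> simp

/-- For the recursively defined operators `D_n`, `C_n` of the Felderhof
model there is a decomposition `C_n = ∑_{j=1}^n C_n^{(j)}` satisfying the exchange algebra
of Lemma 1.  (Spectral parameters are `1`-indexed: `u 1, u 2, …`.) -/
theorem felderhof_operator_algebra (p q : ℂ) (hp : p ≠ 0) (u : ℕ → ℂ)
    (hdist : ∀ i j, 1 ≤ i → 1 ≤ j → i ≠ j → u i ≠ u j)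
    (hden : ∀ j, 1 ≤ j → 1 - p * q * u j ≠ 0)
    (hpu : ∀ j, 1 ≤ j → p * u j - q ≠ 0)
    (D C : (n : ℕ) → Matrix (Fin n → Fin 2) (Fin n → Fin 2) ℂ)
    (hD1 : D 1 = Matrix.of fun s t => (!![1 - p * q * u 1, 0; 0, u 1 - p⁻¹ * q]) (s 0) (t 0))
    (hC1 : C 1 = Matrix.of fun s t => (!![0, 1 - q ^ 2; 0, 0]) (s 0) (t 0))
    (hDrec : ∀ n, 1 ≤ n →
      D (n + 1) = kron2 !![1 - p * q * u (n + 1), 0; 0, u (n + 1) - p⁻¹ * q] (D n)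
        + kron2 !![0, 0; (1 - p ^ 2) * u (n + 1), 0] (C n))
    (hCrec : ∀ n, 1 ≤ n →
      C (n + 1) = kron2 !![0, 1 - q ^ 2; 0, 0] (D n)
        + kron2 !![-p ^ 2 * (1 - p⁻¹ * q * u (n + 1)), 0; 0, u (n + 1) - p * q] (C n)) :
    ∀ n, 1 ≤ n → ∃ Cj : Fin n → Matrix (Fin n → Fin 2) (Fin n → Fin 2) ℂ,
      C n = ∑ j, Cj j ∧
      (∀ j, Cj j * D n
          = ((u ((j : ℕ) + 1) - p⁻¹ * q) / (1 - p * q * u ((j : ℕ) + 1))) • (D n * Cj j)) ∧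
      (∀ j, Cj j * Cj j = 0) ∧
      (∀ j k, j ≠ k → Cj j * Cj k
          = (-((p * u ((j : ℕ) + 1) - q) * (1 - p * q * u ((k : ℕ) + 1)))
              / ((p * u ((k : ℕ) + 1) - q) * (1 - p * q * u ((j : ℕ) + 1)))) • (Cj k * Cj j)) := by
  intro N hN
  rcases eq_or_ne (1 - q ^ 2) 0 with hs | hs
  · have hC0 : ∀ n, 1 ≤ n → C n = 0 := by
      intro n hn
      induction n, hn using Nat.le_induction with
      | base =>
        rw [hC1, hs]
        ext σ τ
        generalize hi : σ 0 = i
        generalize hj : τ 0 = j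
        fin_cases i <;> fin_cases j <;> simp [hi, hj]
      | succ n hn ih =>
        rw [hCrec n hn, ih, hs]
        ext σ τ
        generalize hi : σ 0 = i
        generalize hj : τ 0 = j
        fin_cases i <;> fin_cases j <;> simp [kron2, hi, hj]
    exact ⟨fun _ => 0, by simp [hC0 N hN], by simp, by simp, by simp⟩
  set lam : ℕ → ℂ := fun j => (u (j + 1) - p⁻¹ * q) / (1 - p * q * u (j + 1)) with hlam
  have ha : ∀ j, 1 - p * q * u (j + 1) ≠ 0 := fun j => hden _ (Nat.le_add_left 1 j)
  have hb' : ∀ j, p * u (j + 1) - q ≠ 0 := fun j => hpu _ (Nat.le_add_left 1 j)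
  have hb : ∀ j, u (j + 1) - p⁻¹ * q ≠ 0 := by
    intro j h0
    apply hb' j
    field_simp at h0
    linear_combination h0
  have hl : ∀ j, lam j ≠ 0 := fun j => div_ne_zero (hb j) (ha j)
  have hne : ∀ n, ∀ j < n, lam j ≠ lam n := by
    intro n j hj h0
    have hu := hdist (j + 1) (n + 1) (by omega) (by omega) (by omega)
    rw [hlam, div_eq_div_iff (ha j) (ha n)] at h0
    have h1 : (1 - q ^ 2) * (u (j + 1) - u (n + 1)) = 0 := by
      linear_combination h0 + q ^ 2 * (u (j + 1) - u (n + 1)) * mul_inv_cancel₀ hp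
    exact (mul_ne_zero hs (sub_ne_zero.mpr hu)) h1
  have hfree : ∀ n, -p ^ 2 * (1 - p⁻¹ * q * u (n + 1)) * (u (n + 1) - p⁻¹ * q)
      + (u (n + 1) - p * q) * (1 - p * q * u (n + 1))
      = (1 - q ^ 2) * ((1 - p ^ 2) * u (n + 1)) := by
    intro n
    field_simp
    ring
  have hdec : HasExchangeDecomposition lam N (D N) (C N) := by
    induction N, hN using Nat.le_induction with
    | base =>
      have h0 : HasExchangeDecomposition lam 0
          (1 : Matrix (Fin 0 → Fin 2) (Fin 0 → Fin 2) ℂ) 0 :=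
        ⟨isUnit_one, fun _ => 0, by simp, by simp, by simp⟩
      convert h0.kron2_step (ha 0) (hb 0) rfl (fun j _ => hl j) (hne 0) (hfree 0) using 1
      · rw [hD1]
        ext σ τ
        simp [kron2, Matrix.one_apply,
          Subsingleton.elim (fun i : Fin 0 => σ i.succ) fun i => τ i.succ]
      · rw [hC1]
        ext σ τ
        simp [kron2, Matrix.one_apply,
          Subsingleton.elim (fun i : Fin 0 => σ i.succ) fun i => τ i.succ]
    | succ n hn ih =>
      rw [hDrec n hn, hCrec n hn]
      exact ih.kron2_step (ha n) (hb n) rfl (fun j _ => hl j) (hne n) (hfree n)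
  obtain ⟨-, X, hC, hXD, hXX⟩ := hdec
  refine ⟨X, hC, hXD, fun j => ?_, fun j k _ => ?_⟩
  · have h2 := hXX j j
    rw [eq_neg_iff_add_eq_zero, ← add_smul, ← two_mul] at h2
    exact (smul_eq_zero (M := Matrix (Fin N → Fin 2) (Fin N → Fin 2) ℂ).mp h2).resolve_left (mul_ne_zero two_ne_zero (hl j))
  · rw [← inv_smul_smul₀ (hl k) (X j * X k), hXX, smul_neg, smul_smul, ← neg_smul]
    congr 1
    have h1 := ha j
    have h2 := ha k
    have h3 := hb' k
    simp only [hlam]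
    have hp' : ∀ x : ℂ, x - p⁻¹ * q = (p * x - q) / p := by
      intro x
      field_simp
    rw [hp', hp']
    field_simp
end
end

section
/- Let β ∈ ℂ, N ≥ 1, λ = (λ₁ ≥ ⋯ ≥ λ_N ≥ 0) a partition, and let z₁,…,z_N be complex numbers with z_j pairwise distinct, 1+2βz_k ≠ 0 for all k, and z_j + z_k + 2βz_jz_k ≠ 0 for all j < k. Then the Schur polynomial satisfies s_λ(z) = [∏_{1≤j<k≤N}(z_j + z_k + 2βz_jz_k)]⁻¹ · Σ_{x^{(N)} ≻ x^{(N−1)} ≻ ⋯ ≻ x^{(0)} = ∅} ∏_{k=1}^N { z_k^{Σ_{j=1}^k x_j^{(k)} − Σ_{j=1}^{k−1} x_j^{(k−1)} − 1} · ( 2(1+βz_k)/(1+2βz_k) )^{#(x^{(k)}|x^{(k−1)}) − 1} · ∏_{j=1}^{k−1} ( 1 + 2βz_k(1 − δ_{x_j^{(k−1)}, x_{j+1}^{(k)}}) ) }, where the sum is over all chains of strict partitions x^{(k)} = (x_1^{(k)} > ⋯ > x_k^{(k)} ≥ 1) of length k for k = 0,1,…,N satisfying the interlacing conditions, with x^{(N)}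 fixed by λ via λ_j = x_j^{(N)} − N + j − 1. -/
noncomputable section

/-- The Schur polynomial `s_λ(z₁,…,z_n) = det(z_j^{λ_k+n−k}) / ∏_{j<k}(z_j − z_k)`. -/
def schurC (n : ℕ) (lam : Fin n → ℕ) (t : Fin n → ℂ) : ℂ :=
  Matrix.det (Matrix.of fun j k : Fin n => t j ^ (lam k + (n - 1 - (k : ℕ))))
    / ∏ j : Fin n, ∏ k : Fin n, if j < k then t j - t k else 1

/-- The local weight of a part `y` of a row lying below two consecutive parts `b < a` of the row
above it. -/
def interlaceWeight (β z : ℂ) (a b y : ℕ) : ℂ :=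
  if y = b then 1 else if y = a then 1 + 2 * β * z else 2 * (1 + β * z)

lemma sum_interlaceWeight (β z t : ℂ) {a b : ℕ} (hb : 1 ≤ b) (hab : b < a) :
    (t - z) * ∑ y ∈ Finset.Icc b a, interlaceWeight β z a b y * z ^ (a - y) * t ^ (y - 1)
      = (t + z + 2 * β * t * z) * (t ^ (a - 1) - z ^ (a - b) * t ^ (b - 1)) := by
  obtain ⟨c, rfl⟩ := Nat.exists_eq_add_of_le' hb
  obtain ⟨m, rfl⟩ := Nat.exists_eq_add_of_lt hab
  have hsplit : ∀ y ∈ Finset.Icc (c + 1) (c + 1 + m + 1),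
      interlaceWeight β z (c + 1 + m + 1) (c + 1) y * z ^ (c + 1 + m + 1 - y) * t ^ (y - 1)
        = (if y < c + 1 + m + 1 then z ^ (c + 1 + m + 1 - y) * t ^ (y - 1) else 0)
          + (1 + 2 * β * z)
            * (if c + 1 < y then z ^ (c + 1 + m + 1 - y) * t ^ (y - 1) else 0) := by
    intro y hy
    rw [Finset.mem_Icc] at hy
    unfold interlaceWeight
    split_ifs <;> first | omega | ring
  rw [Finset.sum_congr rfl hsplit, Finset.sum_add_distrib, ← Finset.mul_sum,
    ← Finset.sum_filter, ← Finset.sum_filter]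
  have hlow : ∑ y ∈ Finset.Icc (c + 1) (c + 1 + m + 1) with y < c + 1 + m + 1,
      z ^ (c + 1 + m + 1 - y) * t ^ (y - 1)
        = z * t ^ c * ∑ i ∈ Finset.range (m + 1), t ^ i * z ^ (m + 1 - 1 - i) := by
    rw [Finset.mul_sum]
    symm
    refine Finset.sum_bij' (fun i _ => c + 1 + i) (fun y _ => y - (c + 1)) ?_ ?_ ?_ ?_ ?_
    · intro i hi; simp only [Finset.mem_filter, Finset.mem_Icc, Finset.mem_range] at *; omega
    · intro i hi; simp only [Finset.mem_filter, Finset.mem_Icc, Finset.mem_range] at *; omega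
    · intro i hi; simp
    · intro i hi; simp only [Finset.mem_filter, Finset.mem_Icc] at hi; omega
    · intro i hi
      rw [Finset.mem_range] at hi
      rw [show c + 1 + m + 1 - (c + 1 + i) = (m + 1 - 1 - i) + 1 by omega,
        show c + 1 + i - 1 = c + i by omega]
      ring
  have hhigh : ∑ y ∈ Finset.Icc (c + 1) (c + 1 + m + 1) with c + 1 < y,
      z ^ (c + 1 + m + 1 - y) * t ^ (y - 1)
        = t * t ^ c * ∑ i ∈ Finset.range (m + 1), t ^ i * z ^ (m + 1 - 1 - i) := by
    rw [Finset.mul_sum]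
    symm
    refine Finset.sum_bij' (fun i _ => c + 2 + i) (fun y _ => y - (c + 2)) ?_ ?_ ?_ ?_ ?_
    · intro i hi; simp only [Finset.mem_filter, Finset.mem_Icc, Finset.mem_range] at *; omega
    · intro i hi; simp only [Finset.mem_filter, Finset.mem_Icc, Finset.mem_range] at *; omega
    · intro i hi; simp
    · intro i hi; simp only [Finset.mem_filter, Finset.mem_Icc] at hi; omega
    · intro i hi
      rw [Finset.mem_range] at hi
      rw [show c + 1 + m + 1 - (c + 2 + i) = m + 1 - 1 - i by omega,
        show c + 2 + i - 1 = c + i + 1 by omega]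
      ring
  rw [hlow, hhigh, show c + 1 + m + 1 - (c + 1) = m + 1 by omega,
    show c + 1 + m + 1 - 1 = c + (m + 1) by omega, show c + 1 - 1 = c by omega]
  have hgeom := geom_sum₂_mul t z (m + 1)
  linear_combination (t + z + 2 * β * t * z) * t ^ c * hgeom

lemma det_eq_of_forall_col_eq_smul_add_succ {R : Type*} [CommRing R] {n : ℕ}
    {A B : Matrix (Fin (n + 1)) (Fin (n + 1)) R} (c : Fin n → R)
    (A_last : ∀ i, A i (Fin.last n) = B i (Fin.last n))
    (A_castSucc : ∀ i (j : Fin n), A i j.castSucc = B i j.castSucc + c j * A i j.succ) :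
    A.det = B.det := by
  rw [← Matrix.det_submatrix_equiv_self Fin.revPerm A,
    ← Matrix.det_submatrix_equiv_self Fin.revPerm B]
  refine Matrix.det_eq_of_forall_col_eq_smul_add_pred (fun j => c j.rev) ?_ ?_
  · intro i; simp [A_last]
  · intro i j; simp [Fin.rev_succ, Fin.rev_castSucc, A_castSucc]

lemma det_snoc_pow (n : ℕ) (z : ℂ) (t : Fin n → ℂ) (x : Fin (n + 1) → ℕ) (hx : StrictAnti x)
    (hpos : ∀ i, 1 ≤ x i) :
    Matrix.det (Matrix.of fun i k => (Fin.snoc t z : Fin (n + 1) → ℂ) i ^ (x k - 1))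
      = z ^ (x (Fin.last n) - 1) * Matrix.det (Matrix.of fun i k : Fin n =>
          t i ^ (x k.castSucc - 1)
            - z ^ (x k.castSucc - x k.succ) * t i ^ (x k.succ - 1)) := by
  set s : Fin (n + 1) → ℂ := Fin.snoc t z with hs
  let B : Matrix (Fin (n + 1)) (Fin (n + 1)) ℂ := Matrix.of fun i => Fin.snoc
    (fun k : Fin n => s i ^ (x k.castSucc - 1)
      - z ^ (x k.castSucc - x k.succ) * s i ^ (x k.succ - 1)) (s i ^ (x (Fin.last n) - 1))
  rw [det_eq_of_forall_col_eq_smul_add_succ (B := B)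
    (fun k => z ^ (x k.castSucc - x k.succ)) (by simp [B]) (by simp [B])]
  rw [Matrix.det_succ_row B (Fin.last n), Fin.sum_univ_castSucc]
  have hzero : ∀ k : Fin n, B (Fin.last n) k.castSucc = 0 := by
    intro k
    have h1 : x k.succ < x k.castSucc := hx (Fin.castSucc_lt_succ)
    have h2 := hpos k.succ
    simp only [B, hs, Matrix.of_apply, Fin.snoc_castSucc, Fin.snoc_last]
    rw [← pow_add, show x k.castSucc - x k.succ + (x k.succ - 1) = x k.castSucc - 1 by omega,
      sub_self]
  simp only [hzero, mul_zero, zero_mul, Finset.sum_const_zero, zero_add, Fin.val_last]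
  rw [Even.neg_one_pow ⟨n, rfl⟩, one_mul]
  congr 1
  · simp [B, hs]
  · congr 1
    ext i k
    simp [B, hs]

lemma det_sum_col {ι κ : Type*} [Fintype ι] [DecidableEq ι] (S : ι → Finset κ)
    (g : ι → κ → ι → ℂ) :
    ∑ y ∈ Fintype.piFinset S, Matrix.det (Matrix.of fun i k => g k (y k) i)
      = Matrix.det (Matrix.of fun i k => ∑ y ∈ S k, g k y i) := by
  rw [← Matrix.det_transpose]
  have h := (Matrix.detRowAlternating : (ι → ℂ) [⋀^ι]→ₗ[ℂ] ℂ).toMultilinearMap.map_sum_finset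
    (fun k y => g k y) S
  have hM : (Matrix.of fun i k => ∑ y ∈ S k, g k y i).transpose
      = (fun k => ∑ y ∈ S k, g k y : Matrix ι ι ℂ) := by
    ext i k; simp
  rw [hM]
  refine Eq.trans ?_ h.symm
  refine Finset.sum_congr rfl fun y _ => ?_
  rw [← Matrix.det_transpose]
  rfl

lemma sum_interlace_det (β z : ℂ) {n : ℕ} (t : Fin n → ℂ) (x : Fin (n + 1) → ℕ)
    (hx : StrictAnti x) (hpos : ∀ i, 1 ≤ x i) (ht : ∀ i, t i ≠ z) :
    ∑ y ∈ Fintype.piFinset (fun k : Fin n => Finset.Icc (x k.succ) (x k.castSucc)),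
        z ^ (∑ i, x i - ∑ k, y k - 1)
          * (∏ k, interlaceWeight β z (x k.castSucc) (x k.succ) (y k))
          * Matrix.det (Matrix.of fun i k => t i ^ (y k - 1))
      = (∏ i, (t i + z + 2 * β * t i * z) / (t i - z))
          * Matrix.det (Matrix.of fun i k =>
              (Fin.snoc t z : Fin (n + 1) → ℂ) i ^ (x k - 1)) := by
  rw [det_snoc_pow n z t x hx hpos]
  have hterm : ∀ y ∈ Fintype.piFinset
      (fun k : Fin n => Finset.Icc (x k.succ) (x k.castSucc)),
      z ^ (∑ i, x i - ∑ k, y k - 1)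
          * (∏ k, interlaceWeight β z (x k.castSucc) (x k.succ) (y k))
          * Matrix.det (Matrix.of fun i k => t i ^ (y k - 1))
        = z ^ (x (Fin.last n) - 1) * Matrix.det (Matrix.of fun i k =>
            interlaceWeight β z (x k.castSucc) (x k.succ) (y k) * z ^ (x k.castSucc - y k)
              * t i ^ (y k - 1)) := by
    intro y hy
    have hle : ∀ k ∈ Finset.univ, y k ≤ x (Fin.castSucc k) := fun k _ =>
      (Finset.mem_Icc.mp (Fintype.mem_piFinset.mp hy k)).2
    have hexp : ∑ i, x i - ∑ k, y k - 1
        = (x (Fin.last n) - 1) + ∑ k : Fin n, (x k.castSucc - y k) := by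
      rw [Fin.sum_univ_castSucc, Finset.sum_tsub_distrib _ hle]
      have := Finset.sum_le_sum hle
      have := hpos (Fin.last n)
      omega
    have hdet := Matrix.det_mul_row
      (fun k => interlaceWeight β z (x k.castSucc) (x k.succ) (y k) * z ^ (x k.castSucc - y k))
      (Matrix.of fun i k => t i ^ (y k - 1))
    simp only [Matrix.of_apply] at hdet
    rw [hdet, hexp, pow_add, ← Finset.prod_pow_eq_pow_sum, Finset.prod_mul_distrib]
    ring
  rw [Finset.sum_congr rfl hterm, ← Finset.mul_sum,
    det_sum_col _ (fun k y i => interlaceWeight β z (x k.castSucc) (x k.succ) y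
      * z ^ (x k.castSucc - y) * t i ^ (y - 1)),
    mul_left_comm, ← Matrix.det_mul_column]
  congr 3
  ext i k
  have hne : t i - z ≠ 0 := sub_ne_zero.mpr (ht i)
  have h := sum_interlaceWeight β z (t i) (hpos k.succ) (hx (Fin.castSucc_lt_succ (i := k)))
  simp only [Matrix.of_apply]
  field_simp
  linear_combination h

/-- The single-row weight of the combinatorial formula factorises over the parts of the lower
row. -/
lemma row_weight_eq_prod_interlaceWeight (β z : ℂ) (hz : 1 + 2 * β * z ≠ 0) {n : ℕ}
    (x : Fin (n + 1) → ℕ) (y : Fin n → ℕ) (hx : StrictAnti x) (hy : StrictAnti y)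
    (hxy : ∀ k, x k.succ ≤ y k ∧ y k ≤ x k.castSucc) :
    (2 * (1 + β * z) / (1 + 2 * β * z)) ^
        ((Finset.univ.filter fun j => ∀ i, y i ≠ x j).card - 1)
        * ∏ k, (1 + 2 * β * z * (1 - (if y k = x k.succ then 1 else 0)))
      = ∏ k, interlaceWeight β z (x k.castSucc) (x k.succ) (y k) := by
  have hcommon : (Finset.univ.filter fun j => ∃ i, y i = x j).card
      = (Finset.univ.filter fun i => ∃ j, y i = x j).card := by
    rw [← Finset.card_image_of_injective _ hx.injective,
      ← Finset.card_image_of_injective (Finset.univ.filter fun i => ∃ j, y i = x j) hy.injective]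
    congr 1
    ext v
    simp only [Finset.mem_image, Finset.mem_filter, Finset.mem_univ, true_and]
    constructor
    · rintro ⟨j, ⟨i, hi⟩, rfl⟩; exact ⟨i, ⟨j, hi⟩, hi⟩
    · rintro ⟨i, ⟨j, hj⟩, rfl⟩; exact ⟨j, ⟨i, hj⟩, hj.symm⟩
  have hupper := Finset.card_filter_add_card_filter_not
    (s := (Finset.univ : Finset (Fin (n + 1)))) (fun j => ∃ i, y i = x j)
  have hlower := Finset.card_filter_add_card_filter_not
    (s := (Finset.univ : Finset (Fin n))) (fun i => ∃ j, y i = x j)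
  simp only [not_exists, Finset.card_univ, Fintype.card_fin] at hupper hlower
  rw [show (Finset.univ.filter fun j => ∀ i, y i ≠ x j).card - 1
    = (Finset.univ.filter fun i => ∀ j, y i ≠ x j).card by simp only [ne_eq]; omega]
  rw [← Finset.prod_const, Finset.prod_filter, ← Finset.prod_mul_distrib]
  refine Finset.prod_congr rfl fun k _ => ?_
  have hmem : (∀ j, y k ≠ x j) ↔ y k ≠ x k.castSucc ∧ y k ≠ x k.succ := by
    refine ⟨fun h => ⟨h _, h _⟩, fun ⟨h1, h2⟩ j hj => ?_⟩
    rcases lt_or_ge k.castSucc j with h | h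
    · have := hx.antitone (Fin.castSucc_lt_iff_succ_le.mp h)
      have := (hxy k).1
      omega
    · have := hx.antitone h
      have := (hxy k).2
      omega
  have hlt : x k.succ < x k.castSucc := hx Fin.castSucc_lt_succ
  simp only [hmem]
  unfold interlaceWeight
  by_cases h1 : y k = x k.succ
  · simp [h1]
  · by_cases h2 : y k = x k.castSucc
    · simp [h2, hlt.ne']
    · simp [h1, h2, hz]

lemma sum_strictAnti_interlace_det (β z : ℂ) (hz : 1 + 2 * β * z ≠ 0) {n : ℕ} (t : Fin n → ℂ)
    (x : Fin (n + 1) → ℕ) (hx : StrictAnti x) (hpos : ∀ i, 1 ≤ x i) (ht : ∀ i, t i ≠ z) :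
    ∑ y ∈ Fintype.piFinset (fun k : Fin n => Finset.Icc (x k.succ) (x k.castSucc))
        with StrictAnti y,
        z ^ (∑ i, x i - ∑ k, y k - 1)
          * (2 * (1 + β * z) / (1 + 2 * β * z)) ^
              ((Finset.univ.filter fun j => ∀ i, y i ≠ x j).card - 1)
          * (∏ k, (1 + 2 * β * z * (1 - (if y k = x k.succ then 1 else 0))))
          * Matrix.det (Matrix.of fun i k => t i ^ (y k - 1))
      = (∏ i, (t i + z + 2 * β * t i * z) / (t i - z))
          * Matrix.det (Matrix.of fun i k =>
              (Fin.snoc t z : Fin (n + 1) → ℂ) i ^ (x k - 1)) := by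
  rw [← sum_interlace_det β z t x hx hpos ht, Finset.sum_filter]
  refine Finset.sum_congr rfl fun y hy => ?_
  have hxy : ∀ k, x k.succ ≤ y k ∧ y k ≤ x k.castSucc := fun k =>
    Finset.mem_Icc.mp (Fintype.mem_piFinset.mp hy k)
  split_ifs with hstrict
  · rw [← row_weight_eq_prod_interlaceWeight β z hz x y hx hstrict hxy]
    ring
  · have hcol : ∃ i j, i ≠ j ∧ y i = y j := by
      unfold StrictAnti at hstrict
      push Not at hstrict
      obtain ⟨i, j, hij, hle⟩ := hstrict
      refine ⟨i, j, hij.ne, le_antisymm hle ?_⟩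
      have hmono : x j.castSucc ≤ x i.succ := hx.antitone (Fin.le_def.mpr (by simpa using hij))
      exact (hxy j).2.trans (hmono.trans (hxy i).1)
    obtain ⟨i, j, hij, heq⟩ := hcol
    rw [Matrix.det_zero_of_column_eq hij (by simp [heq]), mul_zero]

lemma sum_transfer_succ {α : Type*} [Fintype α] [DecidableEq α] {n : ℕ}
    (W : Fin (n + 1) → α → α → ℂ) (x : α) :
    ∑ X : Fin (n + 2) → α,
        (if X (Fin.last (n + 1)) = x then ∏ k, W k (X k.castSucc) (X k.succ) else 0)
      = ∑ y, W (Fin.last n) y x * ∑ X : Fin (n + 1) → α,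
          (if X (Fin.last n) = y then ∏ k : Fin n, W k.castSucc (X k.castSucc) (X k.succ)
            else 0) := by
  rw [← (Fin.snocEquiv fun _ : Fin (n + 2) => α).sum_comp, Fintype.sum_prod_type]
  simp only [Fin.snocEquiv, Equiv.coe_fn_mk, Fin.snoc_last]
  rw [Finset.sum_eq_single x (fun b _ hb => by simp [hb]) (by simp)]
  simp only [if_true, Finset.mul_sum, mul_ite, mul_zero]
  rw [Finset.sum_comm]
  refine Finset.sum_congr rfl fun X _ => ?_
  rw [Finset.sum_ite_eq, if_pos (Finset.mem_univ _), Fin.prod_univ_castSucc, Fin.succ_last,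
    Fin.snoc_last, Fin.snoc_castSucc, mul_comm]
  simp only [Fin.succ_castSucc, Fin.snoc_castSucc]

/-- The entries of `r` with index below `n` form a strict partition of length `n`, and the
remaining entries vanish. -/
structure IsStrictRow {N M : ℕ} (n : ℕ) (r : Fin N → Fin M) : Prop where
  eq_zero : ∀ j : Fin N, n ≤ (j : ℕ) → (r j : ℕ) = 0
  pos : ∀ j : Fin N, (j : ℕ) < n → 1 ≤ (r j : ℕ)
  lt : ∀ j j' : Fin N, (j : ℕ) < (j' : ℕ) → (j' : ℕ) < n → (r j' : ℕ) < (r j : ℕ)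

lemma succ_lt_of_lt {N : ℕ} {k j : Fin N} (hj : (j : ℕ) < (k : ℕ)) : (j : ℕ) + 1 < N :=
  Nat.lt_of_le_of_lt hj k.isLt

/-- The row `y` of length `k` interlaces with the row `x` of length `k + 1`. -/
def Interlaces {N M : ℕ} (k : Fin N) (y x : Fin N → Fin M) : Prop :=
  ∀ j : Fin N, (hj : (j : ℕ) < (k : ℕ)) →
    (y j : ℕ) ≤ (x j : ℕ) ∧ (x ⟨(j : ℕ) + 1, succ_lt_of_lt hj⟩ : ℕ) ≤ (y j : ℕ)

/-- The weight attached to the consecutive rows `y ≺ x` of lengths `k` and `k + 1`. -/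
def rowWeight {N M : ℕ} (β : ℂ) (z : Fin N → ℂ) (k : Fin N) (y x : Fin N → Fin M) : ℂ :=
  z k ^ ((∑ j ∈ Finset.univ.filter (fun j : Fin N => (j : ℕ) ≤ (k : ℕ)), (x j : ℕ))
          - (∑ j ∈ Finset.univ.filter (fun j : Fin N => (j : ℕ) < (k : ℕ)), (y j : ℕ)) - 1)
    * (2 * (1 + β * z k) / (1 + 2 * β * z k)) ^
        ((Finset.univ.filter (fun j : Fin N => (j : ℕ) ≤ (k : ℕ) ∧
            ∀ i : Fin N, (i : ℕ) < (k : ℕ) → (y i : ℕ) ≠ (x j : ℕ))).card - 1)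
    * ∏ j : Fin N,
        (if hj : (j : ℕ) < (k : ℕ) then
          1 + 2 * β * z k * (1 -
            (if (y j : ℕ) = (x ⟨(j : ℕ) + 1, succ_lt_of_lt hj⟩ : ℕ) then 1 else 0))
        else 1)

lemma filter_lt_eq_map_castLE {N m : ℕ} (h : m ≤ N) (p : Fin N → Prop) [DecidablePred p] :
    (Finset.univ.filter fun j : Fin N => (j : ℕ) < m ∧ p j)
      = (Finset.univ.filter fun i : Fin m => p (Fin.castLE h i)).map (Fin.castLEEmb h) := by
  ext j
  simp only [Finset.mem_filter, Finset.mem_univ, true_and, Finset.mem_map, Fin.castLEEmb_apply]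
  constructor
  · rintro ⟨hj, hp⟩
    exact ⟨⟨j, hj⟩, hp, rfl⟩
  · rintro ⟨i, hp, rfl⟩
    exact ⟨i.isLt, hp⟩

lemma sum_filter_lt_eq_sum_castLE {N m : ℕ} (h : m ≤ N) (f : Fin N → ℕ) :
    ∑ j ∈ Finset.univ.filter (fun j : Fin N => (j : ℕ) < m), f j = ∑ i : Fin m, f (Fin.castLE h i) := by
  have := filter_lt_eq_map_castLE h (fun _ => True)
  simp only [and_true, Finset.filter_true] at this
  rw [this, Finset.sum_map]
  rfl

lemma prod_dite_lt_eq_prod_castLE {N m : ℕ} (h : m ≤ N)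
    (f : (j : Fin N) → (j : ℕ) < m → ℂ) :
    ∏ j : Fin N, (if hj : (j : ℕ) < m then f j hj else 1)
      = ∏ i : Fin m, f (Fin.castLE h i) i.isLt := by
  have hmap := filter_lt_eq_map_castLE h (fun _ => True)
  simp only [and_true, Finset.filter_true] at hmap
  have hsub : ∏ j ∈ Finset.univ.filter (fun j : Fin N => (j : ℕ) < m),
        (if hj : (j : ℕ) < m then f j hj else 1)
      = ∏ j : Fin N, (if hj : (j : ℕ) < m then f j hj else 1) := by
    refine Finset.prod_subset (Finset.filter_subset _ _) fun j _ hj => ?_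
    simp only [Finset.mem_filter, Finset.mem_univ, true_and] at hj
    rw [dif_neg hj]
  rw [← hsub, hmap, Finset.prod_map]
  refine Finset.prod_congr rfl fun i _ => ?_
  exact dif_pos i.isLt

lemma rowWeight_eq_castLE {N M : ℕ} (β : ℂ) (z : Fin N → ℂ) {n : ℕ} (h : n + 1 ≤ N)
    (y x : Fin N → Fin M) (x' : Fin (n + 1) → ℕ) (y' : Fin n → ℕ)
    (hx' : ∀ i, x' i = x (Fin.castLE h i))
    (hy' : ∀ i, y' i = y (Fin.castLE (Nat.le_of_succ_le h) i)) :
    rowWeight β z ⟨n, h⟩ y x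
      = z ⟨n, h⟩ ^ (∑ i, x' i - ∑ k, y' k - 1)
          * (2 * (1 + β * z ⟨n, h⟩) / (1 + 2 * β * z ⟨n, h⟩)) ^
              ((Finset.univ.filter fun j => ∀ i, y' i ≠ x' j).card - 1)
          * ∏ k, (1 + 2 * β * z ⟨n, h⟩ * (1 - (if y' k = x' k.succ then 1 else 0))) := by
  unfold rowWeight
  simp only [← Nat.lt_succ_iff (n := n)]
  rw [sum_filter_lt_eq_sum_castLE (Nat.le_of_succ_le h) (fun j => (y j : ℕ)),
    show n.succ = n + 1 from rfl, sum_filter_lt_eq_sum_castLE h (fun j => (x j : ℕ)),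
    filter_lt_eq_map_castLE h, Finset.card_map,
    prod_dite_lt_eq_prod_castLE (Nat.le_of_succ_le h)]
  simp only [hx', hy']
  congr 4
  congr 1
  ext j
  simp only [Finset.mem_filter, Finset.mem_univ, true_and]
  exact ⟨fun H i => H _ i.isLt, fun H i hi => H ⟨i, hi⟩⟩

lemma sum_rowWeight_mul {N M : ℕ} (β : ℂ) (z : Fin N → ℂ) {n : ℕ} (h : n + 1 ≤ N)
    (x : Fin N → Fin M) (F : (Fin n → ℕ) → ℂ) [DecidablePred fun y : Fin N → Fin M =>
      IsStrictRow n y ∧ Interlaces ⟨n, h⟩ y x]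
    (x' : Fin (n + 1) → ℕ) (hx' : ∀ i, x' i = x (Fin.castLE h i))
    (hpos : ∀ i, 1 ≤ x' i) :
    ∑ y : Fin N → Fin M, (if IsStrictRow n y ∧ Interlaces ⟨n, h⟩ y x then
        rowWeight β z ⟨n, h⟩ y x else 0)
          * F (fun i => y (Fin.castLE (Nat.le_of_succ_le h) i))
      = ∑ y ∈ Fintype.piFinset (fun k : Fin n => Finset.Icc (x' k.succ) (x' k.castSucc))
        with StrictAnti y,
        z ⟨n, h⟩ ^ (∑ i, x' i - ∑ k, y k - 1)
          * (2 * (1 + β * z ⟨n, h⟩) / (1 + 2 * β * z ⟨n, h⟩)) ^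
              ((Finset.univ.filter fun j => ∀ i, y i ≠ x' j).card - 1)
          * (∏ k, (1 + 2 * β * z ⟨n, h⟩ * (1 - (if y k = x' k.succ then 1 else 0))))
          * F y := by
  simp only [ite_mul, zero_mul]
  rw [← Finset.sum_filter]
  refine Finset.sum_bij (fun y _ i => (y (Fin.castLE (Nat.le_of_succ_le h) i) : ℕ))
    ?_ ?_ ?_ ?_
  · intro y hy
    obtain ⟨hrow, hint⟩ := (Finset.mem_filter.mp hy).2
    simp only [Finset.mem_filter, Fintype.mem_piFinset, Finset.mem_Icc, hx']
    refine ⟨fun k => ⟨?_, ?_⟩, fun i j hij => hrow.lt _ _ hij j.isLt⟩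
    · exact (hint (Fin.castLE (Nat.le_of_succ_le h) k) k.isLt).2
    · exact (hint (Fin.castLE (Nat.le_of_succ_le h) k) k.isLt).1
  · intro y₁ hy₁ y₂ hy₂ heq
    have hrow₁ := (Finset.mem_filter.mp hy₁).2.1
    have hrow₂ := (Finset.mem_filter.mp hy₂).2.1
    funext j
    apply Fin.ext
    rcases lt_or_ge (j : ℕ) n with hj | hj
    · exact congrFun heq ⟨j, hj⟩
    · rw [hrow₁.eq_zero j hj, hrow₂.eq_zero j hj]
  · intro y hy
    simp only [Finset.mem_filter, Fintype.mem_piFinset, Finset.mem_Icc] at hy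
    obtain ⟨hxy, hstrict⟩ := hy
    have hbound : ∀ k, y k < M := fun k =>
      (hxy k).2.trans_lt (by rw [hx']; exact (x _).isLt)
    have hM : 0 < M := (x ⟨n, h⟩).pos
    refine ⟨fun j => if hj : (j : ℕ) < n then ⟨y ⟨j, hj⟩, hbound _⟩ else ⟨0, hM⟩, ?_, ?_⟩
    · refine Finset.mem_filter.mpr ⟨Finset.mem_univ _, ⟨?_, ?_, ?_⟩, ?_⟩
      · intro j hj
        simp [Nat.not_lt.mpr hj]
      · intro j hj
        simp only [hj, dif_pos]
        exact (hpos _).trans (hxy ⟨j, hj⟩).1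
      · intro j j' hjj hj'
        simp only [hj', hjj.trans hj', dif_pos]
        exact hstrict (Fin.mk_lt_mk.mpr hjj)
      · intro j hj
        have hj' : (j : ℕ) < n := hj
        simp only [hj', dif_pos]
        have := hxy ⟨j, hj'⟩
        simp only [hx'] at this
        exact ⟨this.2, this.1⟩
    · funext i
      simp
  · intro y _
    rw [rowWeight_eq_castLE β z h y x x' _ hx' fun _ => rfl]

lemma prod_pairs_succ {n : ℕ} (g : Fin (n + 1) → Fin (n + 1) → ℂ) :
    ∏ j, ∏ k, (if j < k then g j k else 1)
      = (∏ j : Fin n, ∏ k : Fin n, if j < k then g j.castSucc k.castSucc else 1)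
        * ∏ j : Fin n, g j.castSucc (Fin.last n) := by
  rw [Fin.prod_univ_castSucc]
  simp only [Fin.prod_univ_castSucc (n := n) (f := fun k => ite (_ < k) _ _),
    Finset.prod_mul_distrib]
  simp [Fin.castSucc_lt_last, (Fin.le_last _).not_gt]

open Classical in
lemma sum_chains_eq_det {N M : ℕ} (β : ℂ) (z : Fin N → ℂ) (hz : ∀ j k, j ≠ k → z j ≠ z k)
    (h1 : ∀ k, (1 : ℂ) + 2 * β * z k ≠ 0) (n : ℕ) (h : n ≤ N) (x : Fin N → Fin M)
    (hx : IsStrictRow n x) :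
    ∑ X : Fin (n + 1) → Fin N → Fin M, (if X (Fin.last n) = x then ∏ k : Fin n,
        (if IsStrictRow k (X k.castSucc) ∧
            Interlaces (Fin.castLE h k) (X k.castSucc) (X k.succ) then
          rowWeight β z (Fin.castLE h k) (X k.castSucc) (X k.succ) else 0) else 0)
      = (∏ j : Fin n, ∏ k : Fin n, if j < k then
            (z (Fin.castLE h j) + z (Fin.castLE h k)
              + 2 * β * z (Fin.castLE h j) * z (Fin.castLE h k))
            / (z (Fin.castLE h j) - z (Fin.castLE h k)) else 1)
        * Matrix.det (Matrix.of fun i k : Fin n =>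
            z (Fin.castLE h i) ^ ((x (Fin.castLE h k) : ℕ) - 1)) := by
  induction n generalizing x with
  | zero =>
    rw [← (Equiv.funUnique (Fin 1) (Fin N → Fin M)).symm.sum_comp]
    simp
  | succ n ih =>
    have hn : n ≤ N := Nat.le_of_succ_le h
    rw [sum_transfer_succ (fun (k : Fin (n + 1)) y x =>
      if IsStrictRow k y ∧ Interlaces (Fin.castLE h k) y x then
        rowWeight β z (Fin.castLE h k) y x else 0)]
    set x' : Fin (n + 1) → ℕ := fun i => x (Fin.castLE h i) with hx'
    have hanti : StrictAnti x' := fun i j hij => hx.lt _ _ hij j.isLt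
    have hpos : ∀ i, 1 ≤ x' i := fun i => hx.pos _ i.isLt
    have hstep := sum_strictAnti_interlace_det β (z ⟨n, h⟩) (h1 _)
      (fun i => z (Fin.castLE hn i)) x' hanti hpos
      (fun i => hz _ _ (Fin.ne_of_lt (Fin.lt_def.mpr i.isLt)))
    have hsnoc : (Fin.snoc (fun i => z (Fin.castLE hn i)) (z ⟨n, h⟩) : Fin (n + 1) → ℂ)
        = fun i => z (Fin.castLE h i) := by
      funext i
      refine Fin.lastCases ?_ (fun i => ?_) i
      · rw [Fin.snoc_last]; rfl
      · rw [Fin.snoc_castSucc]; rfl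
    rw [hsnoc] at hstep
    rw [prod_pairs_succ (fun j k => (z (Fin.castLE h j) + z (Fin.castLE h k)
              + 2 * β * z (Fin.castLE h j) * z (Fin.castLE h k))
            / (z (Fin.castLE h j) - z (Fin.castLE h k))), mul_assoc]
    refine Eq.trans ?_ (congrArg _ hstep)
    rw [← sum_rowWeight_mul β z h x _ x' (fun _ => rfl) hpos, Finset.mul_sum]
    refine Finset.sum_congr rfl fun y _ => ?_
    by_cases hy : IsStrictRow n y
    · rw [mul_left_comm]
      exact congrArg _ (ih hn y hy)
    · simp [hy]

/-- The combinatorial formula for the Schur polynomials obtained from the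
six-vertex model.  A chain of strict partitions `x^{(N)} ≻ ⋯ ≻ x^{(0)} = ∅` is encoded as
`X : Fin (N+1) → Fin N → Fin (λ₁+N+1)`, where the parts of the level-`k` strict partition
`x^{(k)} = (x₁^{(k)} > ⋯ > x_k^{(k)} ≥ 1)` are the entries `X k j` with `(j:ℕ) < (k:ℕ)`
(all remaining entries being pinned to `0`), and the top level is fixed by
`x_j^{(N)} = λ_j + N − j + 1`, i.e. `λ_j = x_j^{(N)} − N + j − 1`. -/
theorem schur_combinatorial_formula (β : ℂ) (N : ℕ) (hN : 1 ≤ N)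
    (lam : Fin N → ℕ) (hlam : Antitone lam)
    (z : Fin N → ℂ) (hz : ∀ j k, j ≠ k → z j ≠ z k)
    (h1 : ∀ k, (1 : ℂ) + 2 * β * z k ≠ 0)
    (h2 : ∀ j k : Fin N, j < k → z j + z k + 2 * β * z j * z k ≠ 0) :
    schurC N lam z
      = (∏ j, ∏ k, if j < k then z j + z k + 2 * β * z j * z k else 1)⁻¹
        * ∑ X ∈ Finset.univ.filter
            (fun X : Fin (N + 1) → Fin N → Fin (lam ⟨0, hN⟩ + N + 1) =>
              (∀ k : Fin (N + 1), ∀ j : Fin N, (k : ℕ) ≤ (j : ℕ) → (X k j : ℕ) = 0) ∧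
              (∀ k : Fin (N + 1), ∀ j : Fin N, (j : ℕ) < (k : ℕ) → 1 ≤ (X k j : ℕ)) ∧
              (∀ k : Fin (N + 1), ∀ j j' : Fin N,
                (j : ℕ) < (j' : ℕ) → (j' : ℕ) < (k : ℕ) → (X k j' : ℕ) < (X k j : ℕ)) ∧
              (∀ k : Fin N, ∀ j : Fin N, (hj : (j : ℕ) < (k : ℕ)) →
                (X k.castSucc j : ℕ) ≤ (X k.succ j : ℕ) ∧
                (X k.succ ⟨(j : ℕ) + 1, by have := k.isLt; omega⟩ : ℕ) ≤ (X k.castSucc j : ℕ)) ∧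
              (∀ j : Fin N, (X (Fin.last N) j : ℕ) = lam j + (N - (j : ℕ)))),
          ∏ k : Fin N,
            z k ^ ((∑ j ∈ Finset.univ.filter (fun j : Fin N => (j : ℕ) ≤ (k : ℕ)),
                      (X k.succ j : ℕ))
                   - (∑ j ∈ Finset.univ.filter (fun j : Fin N => (j : ℕ) < (k : ℕ)),
                      (X k.castSucc j : ℕ)) - 1)
            * (2 * (1 + β * z k) / (1 + 2 * β * z k)) ^
                ((Finset.univ.filter (fun j : Fin N => (j : ℕ) ≤ (k : ℕ) ∧
                    ∀ i : Fin N, (i : ℕ) < (k : ℕ) →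
                      (X k.castSucc i : ℕ) ≠ (X k.succ j : ℕ))).card - 1)
            * ∏ j : Fin N,
                (if hj : (j : ℕ) < (k : ℕ) then
                  1 + 2 * β * z k * (1 -
                    (if (X k.castSucc j : ℕ)
                        = (X k.succ ⟨(j : ℕ) + 1, by have := k.isLt; omega⟩ : ℕ)
                      then 1 else 0))
                else 1) := by
  classical
  have hM : ∀ j : Fin N, lam j + (N - (j : ℕ)) < lam ⟨0, hN⟩ + N + 1 := by
    intro j
    have := hlam (show (⟨0, hN⟩ : Fin N) ≤ j from Nat.zero_le _)
    omega
  let top : Fin N → Fin (lam ⟨0, hN⟩ + N + 1) := fun j => ⟨lam j + (N - (j : ℕ)), hM j⟩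
  have htop : IsStrictRow N top := by
    refine ⟨fun j hj => absurd j.isLt (by omega), fun j hj => ?_, fun j j' hjj hj' => ?_⟩
    · simp only [top]; omega
    · have := hlam (show j ≤ j' from hjj.le)
      simp only [top]; omega
  have hsum := sum_chains_eq_det β z hz h1 N le_rfl top htop
  simp only [Fin.castLE_rfl, id_eq] at hsum
  have hprod : ∏ j, ∏ k, (if j < k then
        (z j + z k + 2 * β * z j * z k) / (z j - z k) else 1)
      = (∏ j, ∏ k, if j < k then z j + z k + 2 * β * z j * z k else 1)
        / ∏ j, ∏ k, if j < k then z j - z k else 1 := by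
    simp only [← Finset.prod_div_distrib]
    refine Finset.prod_congr rfl fun j _ => Finset.prod_congr rfl fun k _ => ?_
    split_ifs <;> simp
  have hne : (∏ j, ∏ k, if j < k then z j + z k + 2 * β * z j * z k else 1) ≠ 0 := by
    refine Finset.prod_ne_zero_iff.mpr fun j _ => Finset.prod_ne_zero_iff.mpr fun k _ => ?_
    split_ifs with hjk
    · exact h2 j k hjk
    · exact one_ne_zero
  have hdet : (Matrix.of fun i k : Fin N => z i ^ ((top k : ℕ) - 1))
      = Matrix.of fun j k : Fin N => z j ^ (lam k + (N - 1 - (k : ℕ))) := by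
    ext i k
    simp only [Matrix.of_apply, top]
    congr 1
    omega
  rw [hprod, hdet] at hsum
  rw [schurC, eq_inv_mul_iff_mul_eq₀ hne, ← mul_div_assoc, mul_div_right_comm, ← hsum,
    Finset.sum_filter]
  refine Finset.sum_congr rfl fun X _ => ?_
  rw [Finset.prod_ite_zero, ← ite_and]
  congr 1
  rw [eq_comm, eq_iff_iff]
  constructor
  · rintro ⟨hzero, hpos, hlt, hint, hlast⟩
    exact ⟨funext fun j => Fin.ext (hlast j),
      fun k _ => ⟨⟨hzero k.castSucc, hpos k.castSucc, hlt k.castSucc⟩, hint k⟩⟩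
  · rintro ⟨hlast, hrows⟩
    have hstrict : ∀ k : Fin (N + 1), IsStrictRow k (X k) := by
      intro k
      refine Fin.lastCases ?_ (fun k => ?_) k
      · rw [hlast]; exact htop
      · exact (hrows k (Finset.mem_univ k)).1
    exact ⟨fun k => (hstrict k).eq_zero, fun k => (hstrict k).pos, fun k => (hstrict k).lt,
      fun k => (hrows k (Finset.mem_univ k)).2, fun j => by rw [hlast]⟩
end
end
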